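/- arXiv:0902.2413 — 3 statements merged into one kernel-verified Lean document; each statement's English description precedes it below -/
import Mathlib

section
/- For every exchangeable Borel probability measure ϱ on cl(Λ)^ℕ the mean entropy R̄(ϱ) := lim_{n→∞} (1/n)·R(ⁿϱ|λ^⊗n) exists in [−∞, 0]; moreover R̄ is affine linear: for all exchangeable Borel probability measures ϱ₁, ϱ₂ on cl(Λ)^ℕ and every t ∈ (0,1), R̄(t·ϱ₁ + (1−t)·ϱ₂) = t·R̄(ϱ₁) + (1−t)·R̄(ϱ₂) (as an identity in [−∞,0], with t·(−∞) := −∞). -/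
open MeasureTheory Real Filter Set
open scoped BigOperators ENNReal

noncomputable section

attribute [local instance] Classical.propDecidable

abbrev Euc : Type := EuclideanSpace ℝ (Fin 3)

/-- The `n`-fold product of the normalized Lebesgue measure `λ` on `Λ`. -/
def piNormLeb (Λ : Set Euc) (n : ℕ) : Measure (Fin n → Euc) :=
  ((volume Λ) ^ n)⁻¹ • volume.restrict (Set.univ.pi fun _ => Λ)

/-- Relative entropy `R(μ|ν) = −∫ ln(dμ/dν) dμ` if `μ ≪ ν` and the integral is
well defined, and `−∞` otherwise. -/
def relEnt {X : Type*} [MeasurableSpace X] (μ ν : Measure X) : EReal :=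
  if μ ≪ ν ∧ Integrable (fun x => Real.log ((μ.rnDeriv ν) x).toReal) μ then
    (((-∫ x, Real.log ((μ.rnDeriv ν) x).toReal ∂μ) : ℝ) : EReal)
  else ⊥

/-- The `n`-th marginal of a measure on the infinite product. -/
def marg (ϱ : Measure (ℕ → Euc)) (n : ℕ) : Measure (Fin n → Euc) :=
  ϱ.map (fun ω => fun i : Fin n => ω (i : ℕ))

/-- Exchangeability: invariance under all finite permutations of the coordinates. -/
def Exchangeable (ϱ : Measure (ℕ → Euc)) : Prop :=
  ∀ σ : Equiv.Perm ℕ, (∃ n : ℕ, ∀ m : ℕ, n ≤ m → σ m = m) →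
    ϱ.map (fun ω => ω ∘ σ) = ϱ

/-- An exchangeable Borel probability measure on `cl(Λ)^ℕ`. -/
def IsExchProbOn (Λ : Set Euc) (ϱ : Measure (ℕ → Euc)) : Prop :=
  IsProbabilityMeasure ϱ ∧ Exchangeable ϱ ∧
    ϱ {ω : ℕ → Euc | ¬ ∀ i : ℕ, ω i ∈ closure Λ} = 0

/-- The relative entropy `R(ⁿϱ|λ^⊗n)` of the `n`-th marginal, with the
convention `R(⁰ϱ|λ^⊗0) := 0`. -/
def margEnt (Λ : Set Euc) (ϱ : Measure (ℕ → Euc)) (n : ℕ) : EReal :=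
  if n = 0 then 0 else relEnt (marg ϱ n) (piNormLeb Λ n)

open InformationTheory Topology

section KullbackLeibler

variable {X Y : Type*} [MeasurableSpace X] [MeasurableSpace Y]

theorem relEnt_eq_neg_klDiv (μ ν : Measure X) [IsProbabilityMeasure μ] [IsProbabilityMeasure ν] :
    relEnt μ ν = -((klDiv μ ν : ℝ≥0∞) : EReal) := by
  unfold relEnt
  split_ifs with h
  · have h2 : Integrable (llr μ ν) μ := h.2
    have hne := klDiv_ne_top h.1 h2
    have ht := toReal_klDiv_of_measure_eq h.1 (by simp)
    rw [EReal.coe_neg, ← EReal.coe_ennreal_toReal hne, ht]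
    rfl
  · have : klDiv μ ν = ∞ := by
      rw [klDiv_eq_top_iff]
      exact fun h1 h2 => h ⟨h1, h2⟩
    simp [this]

/-- Superadditivity of the Kullback-Leibler divergence with respect to a product measure. -/
theorem klDiv_fst_add_klDiv_snd_le [StandardBorelSpace Y] [Nonempty Y]
    (μ : Measure (X × Y)) (ν₁ : Measure X) (ν₂ : Measure Y)
    [IsProbabilityMeasure μ] [IsFiniteMeasure ν₁] [IsProbabilityMeasure ν₂] :
    klDiv μ.fst ν₁ + klDiv μ.snd ν₂ ≤ klDiv μ (ν₁.prod ν₂) := by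
  have h := klDiv_compProd_eq_add μ.fst ν₁ μ.condKernel (ProbabilityTheory.Kernel.const X ν₂)
  rw [Measure.disintegrate, Measure.compProd_const, Measure.compProd_const] at h
  rw [h]
  gcongr
  have h2 := klDiv_map_le μ (μ.fst.prod ν₂) measurable_snd
  rwa [Measure.map_snd_prod, measure_univ, one_smul] at h2

theorem klFun_convexCombination_le {s t a b : ℝ} (hs : 0 ≤ s) (ht : 0 ≤ t) (hst : s + t = 1)
    (ha : 0 ≤ a) (hb : 0 ≤ b) :
    klFun (s * a + t * b) ≤ s * klFun a + t * klFun b :=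
  convexOn_klFun.2 ha hb hs ht hst

theorem mul_mul_log_le {s a f : ℝ} (hs : 0 < s) (ha : 0 ≤ a) (h : s * a ≤ f) :
    s * (a * log a) ≤ s * a * log f + s * -log s * a := by
  rcases ha.eq_or_lt with rfl | ha
  · simp
  · have h1 : log (s * a) ≤ log f := log_le_log (by positivity) h
    rw [log_mul hs.ne' ha.ne'] at h1
    nlinarith [mul_le_mul_of_nonneg_left h1 (by positivity : 0 ≤ s * a)]

theorem le_klFun_convexCombination {s t a b : ℝ} (hs : 0 < s) (ht : 0 < t) (hst : s + t = 1)
    (ha : 0 ≤ a) (hb : 0 ≤ b) :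
    s * klFun a + t * klFun b ≤
      klFun (s * a + t * b) + (s * -log s * a + t * -log t * b) := by
  have h1 := mul_mul_log_le hs ha (f := s * a + t * b) (by nlinarith)
  have h2 := mul_mul_log_le ht hb (f := s * a + t * b) (by nlinarith)
  simp only [klFun_apply]
  linear_combination h1 + h2 + hst

theorem toReal_rnDeriv_convexCombination (μ₁ μ₂ ν : Measure X) [IsFiniteMeasure μ₁]
    [IsFiniteMeasure μ₂] [IsFiniteMeasure ν] {s t : ℝ} (hs : 0 ≤ s) (ht : 0 ≤ t) :
    ∀ᵐ x ∂ν, ((ENNReal.ofReal s • μ₁ + ENNReal.ofReal t • μ₂).rnDeriv ν x).toReal =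
      s * (μ₁.rnDeriv ν x).toReal + t * (μ₂.rnDeriv ν x).toReal := by
  have : IsFiniteMeasure (ENNReal.ofReal s • μ₁) := μ₁.smul_finite ENNReal.ofReal_ne_top
  have : IsFiniteMeasure (ENNReal.ofReal t • μ₂) := μ₂.smul_finite ENNReal.ofReal_ne_top
  filter_upwards [Measure.rnDeriv_add (ENNReal.ofReal s • μ₁) (ENNReal.ofReal t • μ₂) ν,
    Measure.rnDeriv_smul_left_of_ne_top μ₁ ν (r := ENNReal.ofReal s) ENNReal.ofReal_ne_top,
    Measure.rnDeriv_smul_left_of_ne_top μ₂ ν (r := ENNReal.ofReal t) ENNReal.ofReal_ne_top,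
    μ₁.rnDeriv_lt_top ν, μ₂.rnDeriv_lt_top ν] with x h h1 h2 h3 h4
  rw [h, Pi.add_apply, h1, h2, Pi.smul_apply, Pi.smul_apply, smul_eq_mul, smul_eq_mul,
    ENNReal.toReal_add (by finiteness) (by finiteness),
    ENNReal.toReal_mul, ENNReal.toReal_mul, ENNReal.toReal_ofReal hs, ENNReal.toReal_ofReal ht]

theorem klDiv_convexCombination_le (μ₁ μ₂ ν : Measure X) [IsFiniteMeasure μ₁]
    [IsFiniteMeasure μ₂] [IsFiniteMeasure ν] {s t : ℝ} (hs : 0 < s) (ht : 0 < t)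
    (hst : s + t = 1) :
    klDiv (ENNReal.ofReal s • μ₁ + ENNReal.ofReal t • μ₂) ν ≤
      ENNReal.ofReal s * klDiv μ₁ ν + ENNReal.ofReal t * klDiv μ₂ ν := by
  have hs' : ENNReal.ofReal s ≠ 0 := by simpa using hs
  have ht' : ENNReal.ofReal t ≠ 0 := by simpa using ht
  have : IsFiniteMeasure (ENNReal.ofReal s • μ₁) := μ₁.smul_finite ENNReal.ofReal_ne_top
  have : IsFiniteMeasure (ENNReal.ofReal t • μ₂) := μ₂.smul_finite ENNReal.ofReal_ne_top
  by_cases h1 : μ₁ ≪ ν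
  swap; · simp [klDiv_of_not_ac h1, ENNReal.mul_top hs']
  by_cases h2 : μ₂ ≪ ν
  swap; · simp [klDiv_of_not_ac h2, ENNReal.mul_top ht']
  rw [klDiv_eq_lintegral_klFun_of_ac h1, klDiv_eq_lintegral_klFun_of_ac h2,
    klDiv_eq_lintegral_klFun_of_ac
      (Measure.AbsolutelyContinuous.add_left (h1.smul_left _) (h2.smul_left _)),
    ← lintegral_const_mul _ (by fun_prop), ← lintegral_const_mul _ (by fun_prop),
    ← lintegral_add_left (by fun_prop)]
  refine lintegral_mono_ae ?_
  filter_upwards [toReal_rnDeriv_convexCombination μ₁ μ₂ ν hs.le ht.le] with x hx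
  rw [hx, ← ENNReal.ofReal_mul hs.le, ← ENNReal.ofReal_mul ht.le, ← ENNReal.ofReal_add
    (mul_nonneg hs.le (klFun_nonneg ENNReal.toReal_nonneg))
    (mul_nonneg ht.le (klFun_nonneg ENNReal.toReal_nonneg))]
  exact ENNReal.ofReal_le_ofReal (klFun_convexCombination_le hs.le ht.le hst
    ENNReal.toReal_nonneg ENNReal.toReal_nonneg)

theorem le_klDiv_convexCombination (μ₁ μ₂ ν : Measure X) [IsProbabilityMeasure μ₁]
    [IsProbabilityMeasure μ₂] [IsFiniteMeasure ν] {s t : ℝ} (hs : 0 < s) (ht : 0 < t)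
    (hst : s + t = 1) :
    ENNReal.ofReal s * klDiv μ₁ ν + ENNReal.ofReal t * klDiv μ₂ ν ≤
      klDiv (ENNReal.ofReal s • μ₁ + ENNReal.ofReal t • μ₂) ν +
        (ENNReal.ofReal (s * -log s) + ENNReal.ofReal (t * -log t)) := by
  have hs' : ENNReal.ofReal s ≠ 0 := by simpa using hs
  have ht' : ENNReal.ofReal t ≠ 0 := by simpa using ht
  have hls : 0 ≤ s * -log s :=
    mul_nonneg hs.le (neg_nonneg.2 (log_nonpos hs.le (by linarith)))
  have hlt : 0 ≤ t * -log t :=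
    mul_nonneg ht.le (neg_nonneg.2 (log_nonpos ht.le (by linarith)))
  have : IsFiniteMeasure (ENNReal.ofReal s • μ₁) := μ₁.smul_finite ENNReal.ofReal_ne_top
  have : IsFiniteMeasure (ENNReal.ofReal t • μ₂) := μ₂.smul_finite ENNReal.ofReal_ne_top
  by_cases hac : ENNReal.ofReal s • μ₁ + ENNReal.ofReal t • μ₂ ≪ ν
  swap; · simp [klDiv_of_not_ac hac]
  have h1 : μ₁ ≪ ν := (Measure.absolutelyContinuous_smul hs').trans
    ((Measure.AbsolutelyContinuous.add_right Measure.AbsolutelyContinuous.rfl _).trans hac)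
  have h2 : μ₂ ≪ ν := (Measure.absolutelyContinuous_smul ht').trans
    ((Measure.AbsolutelyContinuous.add_left_iff.1 hac).2)
  have hint (μ : Measure X) [IsProbabilityMeasure μ] (h : μ ≪ ν) {c : ℝ} (hc : 0 ≤ c) :
      ENNReal.ofReal c = ∫⁻ x, ENNReal.ofReal (c * (μ.rnDeriv ν x).toReal) ∂ν := by
    simp_rw [ENNReal.ofReal_mul hc]
    rw [lintegral_const_mul _ (by fun_prop), lintegral_congr_ae
      (g := μ.rnDeriv ν), Measure.lintegral_rnDeriv h, measure_univ, mul_one]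
    filter_upwards [μ.rnDeriv_lt_top ν] with x hx
    exact ENNReal.ofReal_toReal hx.ne
  rw [hint μ₁ h1 hls, hint μ₂ h2 hlt,
    klDiv_eq_lintegral_klFun_of_ac h1, klDiv_eq_lintegral_klFun_of_ac h2,
    klDiv_eq_lintegral_klFun_of_ac hac,
    ← lintegral_const_mul _ (by fun_prop), ← lintegral_const_mul _ (by fun_prop),
    ← lintegral_add_left (by fun_prop), ← lintegral_add_left (by fun_prop),
    ← lintegral_add_left (by fun_prop)]
  refine lintegral_mono_ae ?_
  filter_upwards [toReal_rnDeriv_convexCombination μ₁ μ₂ ν hs.le ht.le] with x hx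
  have ha : 0 ≤ (μ₁.rnDeriv ν x).toReal := ENNReal.toReal_nonneg
  have hb : 0 ≤ (μ₂.rnDeriv ν x).toReal := ENNReal.toReal_nonneg
  have hk : 0 ≤ klFun (s * (μ₁.rnDeriv ν x).toReal + t * (μ₂.rnDeriv ν x).toReal) :=
    klFun_nonneg (by positivity)
  rw [hx, ← ENNReal.ofReal_mul hs.le, ← ENNReal.ofReal_mul ht.le, ← ENNReal.ofReal_add
    (mul_nonneg hs.le (klFun_nonneg ha)) (mul_nonneg ht.le (klFun_nonneg hb)),
    ← ENNReal.ofReal_add (mul_nonneg hls ha) (mul_nonneg hlt hb),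
    ← ENNReal.ofReal_add hk (add_nonneg (mul_nonneg hls ha) (mul_nonneg hlt hb))]
  exact ENNReal.ofReal_le_ofReal (le_klFun_convexCombination hs ht hst ha hb)

end KullbackLeibler

section Superadditive

theorem natCast_mul_le_of_superadditive {u : ℕ → ℝ≥0∞} (hu : ∀ m n, u m + u n ≤ u (m + n))
    (q k : ℕ) : (q : ℝ≥0∞) * u k ≤ u (q * k) := by
  induction q with
  | zero => simp
  | succ q ih =>
    calc ((q + 1 : ℕ) : ℝ≥0∞) * u k = q * u k + u k := by push_cast; ring
      _ ≤ u (q * k) + u k := by gcongr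
      _ ≤ u ((q + 1) * k) := by rw [add_mul, one_mul]; exact hu _ _

theorem tendsto_natCast_div_div_ennreal {k : ℕ} (hk : 0 < k) :
    Tendsto (fun n : ℕ => ((n / k : ℕ) : ℝ≥0∞) / n) atTop (𝓝 (k : ℝ≥0∞)⁻¹) := by
  have h1 : Tendsto (fun n : ℕ => ((n / k : ℕ) : ℝ) / n) atTop (𝓝 (k : ℝ)⁻¹) := by
    have h := (tendsto_nat_floor_mul_div_atTop (R := ℝ) (a := (k : ℝ)⁻¹) (by positivity)).comp
      tendsto_natCast_atTop_atTop
    refine h.congr fun n => ?_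
    simp [Function.comp, inv_mul_eq_div, Nat.floor_div_eq_div]
  have h2 := ENNReal.tendsto_ofReal h1
  rw [ENNReal.ofReal_inv_of_pos (by positivity), ENNReal.ofReal_natCast] at h2
  refine h2.congr' ?_
  filter_upwards [eventually_gt_atTop 0] with n hn
  rw [ENNReal.ofReal_div_of_pos (by positivity), ENNReal.ofReal_natCast, ENNReal.ofReal_natCast]

/-- **Fekete's lemma** for superadditive sequences in `[0, ∞]`. -/
theorem tendsto_div_of_superadditive {u : ℕ → ℝ≥0∞} (hu : ∀ m n, u m + u n ≤ u (m + n)) :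
    Tendsto (fun n : ℕ => u n / n) atTop (𝓝 (⨆ k : {k : ℕ // 0 < k}, u k / (k : ℕ))) := by
  refine tendsto_order.2 ⟨fun c hc => ?_, fun c hc => ?_⟩
  · obtain ⟨⟨k, hk⟩, hck⟩ := lt_iSup_iff.1 hc
    have hlim := ENNReal.Tendsto.mul_const (b := u k) (tendsto_natCast_div_div_ennreal hk)
      (Or.inl (by simp))
    rw [mul_comm, ← div_eq_mul_inv] at hlim
    filter_upwards [hlim.eventually_const_lt hck] with n hn
    refine hn.trans_le ?_
    have h1 : u (n / k * k) ≤ u n := by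
      calc u (n / k * k) ≤ u (n / k * k) + u (n % k) := le_self_add
        _ ≤ u n := by simpa [Nat.div_add_mod'] using hu (n / k * k) (n % k)
    rw [div_eq_mul_inv, mul_right_comm, ← div_eq_mul_inv]
    gcongr
    exact (natCast_mul_le_of_superadditive hu _ _).trans h1
  · filter_upwards [eventually_gt_atTop 0] with n hn
    exact (le_iSup (fun k : {k : ℕ // 0 < k} => u k / (k : ℕ)) ⟨n, hn⟩).trans_lt hc

end Superadditive

section ProductMeasure

variable {X : Type*} [MeasurableSpace X]

theorem map_split_pi (ν : Measure X) [SigmaFinite ν] (n m : ℕ) :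
    (Measure.pi fun _ : Fin (n + m) => ν).map
      (fun x => (fun i : Fin n => x (Fin.castAdd m i), fun j : Fin m => x (Fin.natAdd n j))) =
    (Measure.pi fun _ : Fin n => ν).prod (Measure.pi fun _ : Fin m => ν) := by
  have hmeas : Measurable fun p : (Fin n → X) × (Fin m → X) => Fin.append p.1 p.2 := by
    refine measurable_pi_iff.2 fun i => ?_
    refine Fin.addCases (fun i => ?_) (fun i => ?_) i
    · simp only [Fin.append_left]; fun_prop
    · simp only [Fin.append_right]; fun_prop
  have h : (Measure.pi fun _ : Fin (n + m) => ν) =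
      ((Measure.pi fun _ : Fin n => ν).prod (Measure.pi fun _ : Fin m => ν)).map
        fun p => Fin.append p.1 p.2 := by
    refine Measure.pi_eq fun s hs => ?_
    rw [Measure.map_apply hmeas (MeasurableSet.univ_pi hs)]
    have : (fun p : (Fin n → X) × (Fin m → X) => Fin.append p.1 p.2) ⁻¹' univ.pi s =
        (univ.pi fun i => s (Fin.castAdd m i)) ×ˢ (univ.pi fun j => s (Fin.natAdd n j)) := by
      ext p
      simp [Set.mem_pi, Fin.forall_fin_add]
    rw [this, Measure.prod_prod, Measure.pi_pi, Measure.pi_pi, Fin.prod_univ_add]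
  rw [h, Measure.map_map (by fun_prop) hmeas]
  convert Measure.map_id
  ext p <;> simp

end ProductMeasure

section Reference

variable {Λ : Set Euc}

theorem piNormLeb_eq_pi (h0 : volume Λ ≠ 0) (h1 : volume Λ ≠ ∞) (n : ℕ) :
    piNormLeb Λ n = Measure.pi fun _ : Fin n => (volume Λ)⁻¹ • volume.restrict Λ := by
  have : IsFiniteMeasure ((volume Λ)⁻¹ • volume.restrict Λ) := by
    have : IsFiniteMeasure (volume.restrict Λ) := ⟨by simpa using h1.lt_top⟩
    exact Measure.smul_finite _ (by simpa using h0)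
  symm
  refine Measure.pi_eq fun s hs => ?_
  rw [piNormLeb, volume_pi, Measure.restrict_pi_pi, Measure.smul_apply, Measure.pi_pi]
  simp [Finset.prod_mul_distrib, ENNReal.inv_pow]

theorem isProbabilityMeasure_normLeb (h0 : volume Λ ≠ 0) (h1 : volume Λ ≠ ∞) :
    IsProbabilityMeasure ((volume Λ)⁻¹ • volume.restrict Λ) :=
  ⟨by simp [ENNReal.inv_mul_cancel h0 h1]⟩

theorem isProbabilityMeasure_piNormLeb (h0 : volume Λ ≠ 0) (h1 : volume Λ ≠ ∞) (n : ℕ) :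
    IsProbabilityMeasure (piNormLeb Λ n) := by
  have := isProbabilityMeasure_normLeb h0 h1
  rw [piNormLeb_eq_pi h0 h1]
  infer_instance

end Reference

section Marginals

variable {ϱ : Measure (ℕ → Euc)}

theorem isProbabilityMeasure_marg [IsProbabilityMeasure ϱ] (n : ℕ) :
    IsProbabilityMeasure (marg ϱ n) :=
  Measure.isProbabilityMeasure_map
    (measurable_pi_lambda _ fun _ => measurable_pi_apply _).aemeasurable

/-- The finite permutation of `ℕ` exchanging the block `[0, m)` with the block `[m, m + n)`. -/
def blockSwap (n m : ℕ) : Equiv.Perm ℕ where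
  toFun i := if i < m then n + i else if i < n + m then i - m else i
  invFun i := if i < n then m + i else if i < n + m then i - n else i
  left_inv i := by dsimp only; split_ifs <;> omega
  right_inv i := by dsimp only; split_ifs <;> omega

theorem Exchangeable.map_shift (h : Exchangeable ϱ) (n m : ℕ) :
    ϱ.map (fun ω => fun j : Fin m => ω (n + j)) = marg ϱ m := by
  have hσ := h (blockSwap n m) ⟨n + m, fun i hi => by
    simp only [blockSwap, Equiv.coe_fn_mk]; split_ifs <;> omega⟩
  conv_rhs => rw [marg, ← hσ, Measure.map_map (by fun_prop) (by fun_prop)]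
  congr 1
  ext ω j
  simp [blockSwap]

theorem klDiv_marg_superadditive {Λ : Set Euc} (h0 : volume Λ ≠ 0) (h1 : volume Λ ≠ ∞)
    [IsProbabilityMeasure ϱ] (h : Exchangeable ϱ) (n m : ℕ) :
    klDiv (marg ϱ n) (piNormLeb Λ n) + klDiv (marg ϱ m) (piNormLeb Λ m) ≤
      klDiv (marg ϱ (n + m)) (piNormLeb Λ (n + m)) := by
  have := isProbabilityMeasure_normLeb h0 h1
  have := isProbabilityMeasure_marg (ϱ := ϱ)
  simp only [piNormLeb_eq_pi h0 h1]
  set ν := (volume Λ)⁻¹ • volume.restrict Λ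
  have hmeas : Measurable fun x : Fin (n + m) → Euc =>
    (fun i : Fin n => x (Fin.castAdd m i), fun j : Fin m => x (Fin.natAdd n j)) := by fun_prop
  refine le_trans ?_ (klDiv_map_le _ _ hmeas)
  rw [map_split_pi]
  have : IsProbabilityMeasure ((marg ϱ (n + m)).map fun x =>
      (fun i : Fin n => x (Fin.castAdd m i), fun j : Fin m => x (Fin.natAdd n j))) :=
    Measure.isProbabilityMeasure_map hmeas.aemeasurable
  refine le_of_eq_of_le ?_ (klDiv_fst_add_klDiv_snd_le _ _ _)
  rw [Measure.fst, Measure.snd, marg.eq_def ϱ (n + m),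
    Measure.map_map hmeas (by fun_prop), Measure.map_map measurable_fst (by fun_prop),
    Measure.map_map measurable_snd (by fun_prop), ← h.map_shift n m]
  rfl

theorem marg_convexCombination (ϱ₁ ϱ₂ : Measure (ℕ → Euc)) (a b : ℝ≥0∞) (n : ℕ) :
    marg (a • ϱ₁ + b • ϱ₂) n = a • marg ϱ₁ n + b • marg ϱ₂ n := by
  rw [marg, Measure.map_add _ _ (by fun_prop), Measure.map_smul, Measure.map_smul]
  rfl

theorem IsExchProbOn.convexCombination {Λ : Set Euc} {ϱ₁ ϱ₂ : Measure (ℕ → Euc)}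
    (h₁ : IsExchProbOn Λ ϱ₁) (h₂ : IsExchProbOn Λ ϱ₂) {a b : ℝ≥0∞} (hab : a + b = 1) :
    IsExchProbOn Λ (a • ϱ₁ + b • ϱ₂) := by
  obtain ⟨hp₁, he₁, hs₁⟩ := h₁
  obtain ⟨hp₂, he₂, hs₂⟩ := h₂
  refine ⟨⟨by simp [hab]⟩, fun σ hσ => ?_, by
    rw [Measure.add_apply, Measure.smul_apply, Measure.smul_apply, hs₁, hs₂]; simp⟩
  rw [Measure.map_add _ _ (by fun_prop), Measure.map_smul, Measure.map_smul, he₁ σ hσ, he₂ σ hσ]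

theorem inv_mul_margEnt {Λ : Set Euc} (h0 : volume Λ ≠ 0) (h1 : volume Λ ≠ ∞)
    [IsProbabilityMeasure ϱ] {n : ℕ} (hn : 0 < n) :
    (((n : ℝ)⁻¹ : ℝ) : EReal) * margEnt Λ ϱ n =
      -((klDiv (marg ϱ n) (piNormLeb Λ n) / n : ℝ≥0∞) : EReal) := by
  have := isProbabilityMeasure_marg (ϱ := ϱ) n
  have := isProbabilityMeasure_piNormLeb h0 h1 n
  have hinv : (((n : ℝ)⁻¹ : ℝ) : EReal) = (((n : ℝ≥0∞)⁻¹ : ℝ≥0∞) : EReal) := by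
    rw [← ENNReal.ofReal_natCast, ← ENNReal.ofReal_inv_of_pos (by positivity),
      EReal.coe_ennreal_ofReal, max_eq_left (by positivity)]
  rw [margEnt, if_neg hn.ne', relEnt_eq_neg_klDiv, hinv, div_eq_mul_inv, EReal.coe_ennreal_mul,
    mul_neg, mul_comm]

theorem klDiv_marg_limit_convexCombination {Λ : Set Euc} (h0 : volume Λ ≠ 0)
    (h1 : volume Λ ≠ ∞) {ϱ₁ ϱ₂ : Measure (ℕ → Euc)} [IsProbabilityMeasure ϱ₁]
    [IsProbabilityMeasure ϱ₂] {s t : ℝ} (hs : 0 < s) (ht : 0 < t) (hst : s + t = 1)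
    {L L₁ L₂ : ℝ≥0∞}
    (hL₁ : Tendsto (fun n : ℕ => klDiv (marg ϱ₁ n) (piNormLeb Λ n) / n) atTop (𝓝 L₁))
    (hL₂ : Tendsto (fun n : ℕ => klDiv (marg ϱ₂ n) (piNormLeb Λ n) / n) atTop (𝓝 L₂))
    (hL : Tendsto (fun n : ℕ => klDiv (marg (ENNReal.ofReal s • ϱ₁ + ENNReal.ofReal t • ϱ₂) n)
      (piNormLeb Λ n) / n) atTop (𝓝 L)) :
    L = ENNReal.ofReal s * L₁ + ENNReal.ofReal t * L₂ := by
  have hp₁ := isProbabilityMeasure_marg (ϱ := ϱ₁)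
  have hp₂ := isProbabilityMeasure_marg (ϱ := ϱ₂)
  have hpν := isProbabilityMeasure_piNormLeb h0 h1
  simp only [marg_convexCombination] at hL
  have hsum := (ENNReal.Tendsto.const_mul (a := ENNReal.ofReal s) hL₁
    (Or.inr ENNReal.ofReal_ne_top)).add (ENNReal.Tendsto.const_mul (a := ENNReal.ofReal t) hL₂
    (Or.inr ENNReal.ofReal_ne_top))
  have hconst := ENNReal.Tendsto.const_div
    (a := ENNReal.ofReal (s * -log s) + ENNReal.ofReal (t * -log t))
    ENNReal.tendsto_nat_nhds_top (Or.inr (by finiteness))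
  rw [ENNReal.div_top] at hconst
  have hcorr := hL.add hconst
  rw [add_zero] at hcorr
  refine le_antisymm (le_of_tendsto_of_tendsto' hL hsum fun n => ?_)
    (le_of_tendsto_of_tendsto' hsum hcorr fun n => ?_)
  · rw [← mul_div_assoc, ← mul_div_assoc, ← ENNReal.add_div]
    gcongr
    exact klDiv_convexCombination_le _ _ _ hs ht hst
  · rw [← mul_div_assoc, ← mul_div_assoc, ← ENNReal.add_div, ← ENNReal.add_div]
    exact ENNReal.div_le_div_right (le_klDiv_convexCombination _ _ _ hs ht hst) _

end Marginals

theorem statement12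
    (Λ : Set Euc) (hΛne : Λ.Nonempty) (hΛopen : IsOpen Λ)
    (hΛbdd : Bornology.IsBounded Λ) (hΛconn : IsConnected Λ) :
    ∃ meanEnt : Measure (ℕ → Euc) → EReal,
      (∀ ϱ : Measure (ℕ → Euc), IsExchProbOn Λ ϱ →
        meanEnt ϱ ≤ 0 ∧
        Tendsto (fun n : ℕ => (((n : ℝ)⁻¹ : ℝ) : EReal) * margEnt Λ ϱ n)
          atTop (nhds (meanEnt ϱ))) ∧
      (∀ ϱ₁ ϱ₂ : Measure (ℕ → Euc), IsExchProbOn Λ ϱ₁ → IsExchProbOn Λ ϱ₂ →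
        ∀ t : ℝ, t ∈ Ioo (0 : ℝ) 1 →
          meanEnt (ENNReal.ofReal t • ϱ₁ + ENNReal.ofReal (1 - t) • ϱ₂) =
            ((t : ℝ) : EReal) * meanEnt ϱ₁ + (((1 - t : ℝ)) : EReal) * meanEnt ϱ₂) := by
  have h0 : volume Λ ≠ 0 := (hΛopen.measure_pos volume hΛne).ne'
  have h1 : volume Λ ≠ ∞ := hΛbdd.measure_lt_top.ne
  let L (ϱ : Measure (ℕ → Euc)) : ℝ≥0∞ :=
    ⨆ k : {k : ℕ // 0 < k}, klDiv (marg ϱ k) (piNormLeb Λ k) / (k : ℕ)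
  have hL (ϱ : Measure (ℕ → Euc)) (h : IsExchProbOn Λ ϱ) :
      Tendsto (fun n : ℕ => klDiv (marg ϱ n) (piNormLeb Λ n) / n) atTop (𝓝 (L ϱ)) := by
    have := h.1
    exact tendsto_div_of_superadditive (u := fun n => klDiv (marg ϱ n) (piNormLeb Λ n))
      (klDiv_marg_superadditive h0 h1 h.2.1)
  refine ⟨fun ϱ => -((L ϱ : ℝ≥0∞) : EReal), fun ϱ h =>
    ⟨EReal.neg_le_zero.2 (EReal.coe_ennreal_nonneg _), ?_⟩,
    fun ϱ₁ ϱ₂ h₁ h₂ t ht => ?_⟩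
  · have := h.1
    have hlim := ((continuous_neg.comp continuous_coe_ennreal_ereal).tendsto (L ϱ)).comp (hL ϱ h)
    refine hlim.congr' ?_
    filter_upwards [eventually_gt_atTop 0] with n hn
    exact (inv_mul_margEnt h0 h1 hn).symm
  · have := h₁.1
    have := h₂.1
    have ht0 : 0 < 1 - t := sub_pos.2 ht.2
    have hmix := h₁.convexCombination h₂ (a := ENNReal.ofReal t) (b := ENNReal.ofReal (1 - t))
      (by rw [← ENNReal.ofReal_add ht.1.le ht0.le]; simp)
    have key := klDiv_marg_limit_convexCombination h0 h1 ht.1 ht0 (by ring)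
      (hL _ h₁) (hL _ h₂) (hL _ hmix)
    have hcoe {c : ℝ} (hc : 0 < c) : ((c : ℝ) : EReal) = (ENNReal.ofReal c : EReal) := by
      rw [EReal.coe_ennreal_ofReal, max_eq_left hc.le]
    beta_reduce
    rw [key, hcoe ht.1, hcoe ht0, EReal.coe_ennreal_add, EReal.neg_add
      (Or.inl (EReal.coe_ennreal_ne_bot _)) (Or.inr (EReal.coe_ennreal_ne_bot _)),
      EReal.coe_ennreal_mul, EReal.coe_ennreal_mul, mul_neg, mul_neg, sub_eq_add_neg]
end
end

section
/- Let Λ ⊂ ℝ^D be a nonempty bounded connected open set and assume hypotheses (H1)–(H4) on U. For N ≥ 2 define the pair-specific ground state energy ε_g(N) := min{ (N(N−1))⁻¹·Σ_{1≤i<j≤N} U(q_i,q_j) : (q₁,…,q_N) ∈ cl(Λ)^N } (the minimum is attained by lower semicontinuity and compactness). Then the sequence N ↦ ε_g(N) is nondecreasing, ε_g := min{ ⟨ρ,ρ⟩ : ρ a Borel probability measure on cl(Λ) } is finite, and ε_g(N) → ε_g as N → ∞ (hence ε_g(N) ↑ ε_g). -/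
open MeasureTheory Real Filter Set
open scoped BigOperators ENNReal

noncomputable section

variable (D : ℕ)

abbrev EucD (D : ℕ) : Type := EuclideanSpace ℝ (Fin D)

/-- Interaction energy `I_N(q) = ∑_{i<j} U(q_i, q_j)` (extended-real valued). -/
def interactionE (U : EucD D → EucD D → ℝ≥0∞) (N : ℕ) (q : Fin N → EucD D) : ℝ≥0∞ :=
  ∑ i : Fin N, ∑ j : Fin N, if (i : ℕ) < (j : ℕ) then U (q i) (q j) else 0

/-- The bilinear pairing `⟨ρ,ρ'⟩ = ∬ ½ U(x,y) ρ(dx) ρ'(dy)`. -/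
def pairingE (U : EucD D → EucD D → ℝ≥0∞) (ρ ρ' : Measure (EucD D)) : ℝ≥0∞ :=
  ∫⁻ x, ∫⁻ y, U x y / 2 ∂ρ' ∂ρ

/-- A Borel probability measure concentrated on `cl(Λ)`. -/
def IsProbOn (Λ : Set (EucD D)) (ρ : Measure (EucD D)) : Prop :=
  IsProbabilityMeasure ρ ∧ ρ ((closure Λ)ᶜ) = 0

/-- `ε_g`, the infimum of `⟨ρ,ρ⟩` over Borel probability measures on `cl(Λ)`. -/
def groundEnergyE (U : EucD D → EucD D → ℝ≥0∞) (Λ : Set (EucD D)) : ℝ≥0∞ :=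
  ⨅ ρ ∈ {ρ : Measure (EucD D) | IsProbOn D Λ ρ}, pairingE D U ρ ρ

/-- Hypotheses (H1)–(H4) on the pair interaction `U`. -/
structure HypUE (U : EucD D → EucD D → ℝ≥0∞) (Λ : Set (EucD D)) : Prop where
  /-- (H1) Symmetry. -/
  symm : ∀ x ∈ closure Λ, ∀ y ∈ closure Λ, U x y = U y x
  /-- (H2) Lower semicontinuity on `cl(Λ)×cl(Λ)`. -/
  lsc : LowerSemicontinuousOn (fun p : EucD D × EucD D => U p.1 p.2) (closure Λ ×ˢ closure Λ)
  /-- (H3) Sublevel set regularity. -/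
  sublevel : ∀ δ : ℝ, 0 < δ →
    0 < volume {p : EucD D × EucD D | p.1 ∈ Λ ∧ p.2 ∈ Λ ∧
      U p.1 p.2 < (⨅ x ∈ closure Λ, ⨅ y ∈ closure Λ, U x y) + ENNReal.ofReal δ}
  /-- (H4) Local square integrability. -/
  locL2 : ∀ x ∈ Λ, ∃ r : ℝ, 0 < r ∧ (∫⁻ y in Metric.ball x r ∩ Λ, (U x y) ^ 2) < ⊤

/-- The pair-specific ground state energy
`ε_g(N) = min{ I_N(q)/(N(N−1)) : q ∈ cl(Λ)^N }`. -/
def pairGroundEnergy (U : EucD D → EucD D → ℝ≥0∞) (Λ : Set (EucD D)) (N : ℕ) : ℝ≥0∞ :=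
  ⨅ q ∈ {q : Fin N → EucD D | ∀ i, q i ∈ closure Λ},
    interactionE D U N q / ((N * (N - 1) : ℕ) : ℝ≥0∞)

section PairSum

variable {X : Type*}

/-- The sum of `W (q i) (q j)` over the pairs `i < j`. -/
def pairSum (W : X → X → ℝ≥0∞) (N : ℕ) (q : Fin N → X) : ℝ≥0∞ :=
  ∑ i : Fin N, ∑ j : Fin N, if (i : ℕ) < (j : ℕ) then W (q i) (q j) else 0

/-- The least pair-specific energy of `N` points of `X`. -/
def infPairEnergy (W : X → X → ℝ≥0∞) (N : ℕ) : ℝ≥0∞ :=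
  ⨅ q : Fin N → X, pairSum W N q / ((N * (N - 1) : ℕ) : ℝ≥0∞)

lemma sum_succAbove_eq {N : ℕ} (k : Fin (N + 1)) (g : Fin (N + 1) → ℝ≥0∞) :
    ∑ i : Fin N, g (k.succAbove i) = ∑ i, if i = k then 0 else g i := by
  rw [Fin.sum_univ_succAbove _ k]
  simp [Fin.succAbove_ne]

/-- Summing the interaction of all but one point over the omitted point. -/
lemma sum_pairSum_succAbove (W : X → X → ℝ≥0∞) {N : ℕ} (q : Fin (N + 1) → X) :
    ∑ k : Fin (N + 1), pairSum W N (fun i => q (k.succAbove i)) = ((N - 1 : ℕ) : ℝ≥0∞) * pairSum W (N + 1) q := by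
  set f : Fin (N + 1) → Fin (N + 1) → ℝ≥0∞ :=
    fun i j => if (i : ℕ) < (j : ℕ) then W (q i) (q j) else 0 with hf
  have h1 : ∀ k : Fin (N + 1), pairSum W N (fun i => q (k.succAbove i)) =
      ∑ i, ∑ j, if i = k ∨ j = k then 0 else f i j := by
    intro k
    have : pairSum W N (fun i => q (k.succAbove i)) =
        ∑ i, ∑ j, f (k.succAbove i) (k.succAbove j) := by
      unfold pairSum
      refine Finset.sum_congr rfl fun i _ => Finset.sum_congr rfl fun j _ => ?_
      have : ((k.succAbove i : Fin (N+1)) : ℕ) < (k.succAbove j : Fin (N+1)) ↔ (i : ℕ) < j := by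
        rw [← Fin.lt_def, ← Fin.lt_def]
        exact (Fin.strictMono_succAbove k).lt_iff_lt
      simp only [hf, this]
    rw [this, sum_succAbove_eq k (fun i => ∑ j, f i (k.succAbove j))]
    refine Finset.sum_congr rfl fun i _ => ?_
    rw [sum_succAbove_eq k (fun j => f i j)]
    by_cases hi : i = k <;> simp [hi]
  simp_rw [h1]
  rw [Finset.sum_comm]
  unfold pairSum
  rw [Finset.mul_sum]
  refine Finset.sum_congr rfl fun i _ => ?_
  rw [Finset.sum_comm, Finset.mul_sum]
  refine Finset.sum_congr rfl fun j _ => ?_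
  by_cases hij : (i : ℕ) < j
  · have hne : i ≠ j := fun h => by simp [h] at hij
    have hcard : (Finset.univ.filter fun k : Fin (N + 1) => ¬ (i = k ∨ j = k)).card = N - 1 := by
      have : (Finset.univ.filter fun k : Fin (N + 1) => ¬ (i = k ∨ j = k)) = {i, j}ᶜ := by
        ext k; simp [eq_comm]
      rw [this, Finset.card_compl, Finset.card_pair hne, Fintype.card_fin]
      omega
    have : ∀ k : Fin (N + 1), (if i = k ∨ j = k then 0 else f i j) =
        if ¬ (i = k ∨ j = k) then f i j else 0 := fun k => by
      by_cases h : i = k ∨ j = k <;> simp [h]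
    simp_rw [this]
    rw [← Finset.sum_filter, Finset.sum_const, hcard, nsmul_eq_mul]
  · have : f i j = 0 := if_neg hij
    simp only [this, ite_self, Finset.sum_const_zero]
    rw [if_neg hij, mul_zero]

lemma infPairEnergy_le_succ (W : X → X → ℝ≥0∞) {N : ℕ} (hN : 2 ≤ N) :
    infPairEnergy W N ≤ infPairEnergy W (N + 1) := by
  refine le_iInf fun q => ?_
  have h0 : ((N * (N - 1) : ℕ) : ℝ≥0∞) ≠ 0 := by
    have : N * (N - 1) ≠ 0 := Nat.mul_ne_zero (by omega) (by omega)
    exact_mod_cast this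
  have h1 : ∀ k : Fin (N + 1), infPairEnergy W N * ((N * (N - 1) : ℕ) : ℝ≥0∞) ≤
      pairSum W N (fun i => q (k.succAbove i)) := fun k => by
    rw [← ENNReal.le_div_iff_mul_le (Or.inl h0) (Or.inl (ENNReal.natCast_ne_top _))]
    exact iInf_le _ _
  have h2 := Finset.sum_le_sum fun k (_ : k ∈ Finset.univ) => h1 k
  rw [sum_pairSum_succAbove, Finset.sum_const, Finset.card_univ, Fintype.card_fin,
    nsmul_eq_mul] at h2
  have h3 : ((N - 1 : ℕ) : ℝ≥0∞) ≠ 0 := by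
    have : N - 1 ≠ 0 := by omega
    exact_mod_cast this
  rw [ENNReal.le_div_iff_mul_le (Or.inl (by simp; omega)) (Or.inl (ENNReal.natCast_ne_top _))]
  rw [← ENNReal.mul_le_mul_iff_right h3 (ENNReal.natCast_ne_top _)]
  refine le_trans (le_of_eq ?_) h2
  push_cast [Nat.add_sub_cancel]
  ring

lemma infPairEnergy_monotone (W : X → X → ℝ≥0∞) [Nonempty X] : Monotone (infPairEnergy W) := by
  have h : ∀ N < 2, infPairEnergy W N = 0 := by
    intro N hN
    interval_cases N <;> simp [infPairEnergy, pairSum]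
  refine monotone_nat_of_le_succ fun N => ?_
  rcases lt_or_ge N 2 with hN | hN
  · rw [h N hN]; exact zero_le
  · exact infPairEnergy_le_succ W hN

lemma two_mul_sum_lt (N : ℕ) (c : ℝ≥0∞) :
    2 * ∑ i : Fin N, ∑ j : Fin N, (if (i : ℕ) < (j : ℕ) then c else 0) =
      ((N * (N - 1) : ℕ) : ℝ≥0∞) * c := by
  have h : ∀ j : Fin N, ∑ i : Fin N, (if (i : ℕ) < (j : ℕ) then c else 0) = (j : ℕ) * c := by
    intro j
    have := Fin.card_Iio j
    rw [← Finset.sum_filter, Finset.sum_const, nsmul_eq_mul]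
    congr 2
    rw [← this]
    congr 1
    ext i
    simp
  rw [Finset.sum_comm]
  simp_rw [h]
  rw [← Finset.sum_mul, Fin.sum_univ_eq_sum_range (fun i => (i : ℝ≥0∞)), ← mul_assoc,
    ← Finset.sum_range_id_mul_two, mul_comm 2]
  push_cast
  rfl

lemma sum_sum_le_two_mul_pairSum (W V : X → X → ℝ≥0∞) (hW : ∀ x y, W x y = W y x)
    (hVW : ∀ x y, V x y ≤ W x y) (M : ℝ≥0∞) (hV : ∀ x y, V x y ≤ M) (N : ℕ) (q : Fin N → X) :
    ∑ i, ∑ j, V (q i) (q j) ≤ 2 * pairSum W N q + N * M := by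
  have h1 : ∀ i j : Fin N, V (q i) (q j) ≤
      ((if (i : ℕ) < (j : ℕ) then W (q i) (q j) else 0) +
       (if (j : ℕ) < (i : ℕ) then W (q j) (q i) else 0)) + (if i = j then M else 0) := by
    intro i j
    rcases lt_trichotomy i j with h | h | h
    · have := Fin.lt_def.1 h
      simp [this, this.not_gt, h.ne, hVW]
    · simp [h, hV]
    · have := Fin.lt_def.1 h
      simp [this, this.not_gt, h.ne', hVW, hW (q j)]
  refine (Finset.sum_le_sum fun i _ => Finset.sum_le_sum fun j _ => h1 i j).trans ?_
  simp only [Finset.sum_add_distrib]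
  rw [Finset.sum_comm (f := fun i j : Fin N => if (j : ℕ) < (i : ℕ) then W (q j) (q i) else 0)]
  simp [pairSum, two_mul]

end PairSum

section Energy

variable {X : Type*} [MeasurableSpace X]

lemma infPairEnergy_le_lintegral (W : X → X → ℝ≥0∞) (hW : Measurable (Function.uncurry W))
    (μ : Measure X) [IsProbabilityMeasure μ] {N : ℕ} (hN : 2 ≤ N) :
    infPairEnergy W N ≤ (∫⁻ x, ∫⁻ y, W x y ∂μ ∂μ) / 2 := by
  set P : Measure (Fin N → X) := Measure.pi fun _ => μ
  have hpair : ∀ i j : Fin N, i ≠ j →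
      ∫⁻ q, W (q i) (q j) ∂P = ∫⁻ x, ∫⁻ y, W x y ∂μ ∂μ := by
    intro i j hij
    have hind : ProbabilityTheory.IndepFun (fun q : Fin N → X => q i) (fun q => q j) P :=
      (ProbabilityTheory.iIndepFun_pi (μ := fun _ : Fin N => μ) (X := fun _ x => x)
        (fun _ => aemeasurable_id)).indepFun hij
    have hmap := (ProbabilityTheory.indepFun_iff_map_prod_eq_prod_map_map
      (measurable_pi_apply i).aemeasurable (measurable_pi_apply j).aemeasurable).1 hind
    rw [(measurePreserving_eval (fun _ : Fin N => μ) i).map_eq,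
      (measurePreserving_eval (fun _ : Fin N => μ) j).map_eq] at hmap
    have h2 : ∫⁻ q, W (q i) (q j) ∂P =
        ∫⁻ z, Function.uncurry W z ∂(P.map fun q => (q i, q j)) := by
      rw [lintegral_map hW (by fun_prop)]
      rfl
    rw [h2, hmap, lintegral_prod _ hW.aemeasurable]
    rfl
  have hmeas : ∀ i j : Fin N, Measurable fun q : Fin N → X =>
      if (i : ℕ) < (j : ℕ) then W (q i) (q j) else 0 := fun i j => by
    split_ifs
    · exact hW.comp (g := Function.uncurry W) (f := fun q : Fin N → X => (q i, q j)) (by fun_prop)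
    · fun_prop
  have hI : ∫⁻ q, pairSum W N q ∂P =
      ∑ i : Fin N, ∑ j : Fin N,
        if (i : ℕ) < (j : ℕ) then ∫⁻ x, ∫⁻ y, W x y ∂μ ∂μ else 0 := by
    unfold pairSum
    rw [lintegral_finsetSum _ fun i _ => Finset.measurable_sum _ fun j _ => hmeas i j]
    refine Finset.sum_congr rfl fun i _ => ?_
    rw [lintegral_finsetSum _ fun j _ => hmeas i j]
    refine Finset.sum_congr rfl fun j _ => ?_
    split_ifs with h
    · exact hpair i j fun h' => by simp [h'] at h
    · simp
  have h0 : ((N * (N - 1) : ℕ) : ℝ≥0∞) ≠ 0 := by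
    have : N * (N - 1) ≠ 0 := Nat.mul_ne_zero (by omega) (by omega)
    exact_mod_cast this
  have hle : infPairEnergy W N * ((N * (N - 1) : ℕ) : ℝ≥0∞) ≤ ∫⁻ q, pairSum W N q ∂P := by
    calc _ = ∫⁻ _, infPairEnergy W N * ((N * (N - 1) : ℕ) : ℝ≥0∞) ∂P := by simp
      _ ≤ _ := lintegral_mono fun q => by
        rw [← ENNReal.le_div_iff_mul_le (Or.inl h0) (Or.inl (ENNReal.natCast_ne_top _))]
        exact iInf_le _ _
  have hle2 := mul_le_mul_right hle 2
  rw [hI, two_mul_sum_lt, mul_comm 2, mul_assoc, mul_comm _ 2, ← mul_assoc, mul_comm (_ * 2),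
    ENNReal.mul_le_mul_iff_right h0 (ENNReal.natCast_ne_top _)] at hle2
  rwa [ENNReal.le_div_iff_mul_le (by simp) (by simp)]

end Energy

section WeakLimits

lemma lintegral_le_liminf_of_lowerSemicontinuous {Ω : Type*} [MeasurableSpace Ω]
    [TopologicalSpace Ω] [OpensMeasurableSpace Ω] [HasOuterApproxClosed Ω]
    {μ : ProbabilityMeasure Ω} {μs : ℕ → ProbabilityMeasure Ω}
    (hμ : Tendsto μs atTop (nhds μ)) {f : Ω → ℝ≥0∞} (hf : LowerSemicontinuous f)
    (hfin : ∀ x, f x ≠ ⊤) :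
    ∫⁻ x, f x ∂(μ : Measure Ω) ≤ atTop.liminf fun n => ∫⁻ x, f x ∂(μs n : Measure Ω) := by
  have hmeas : Measurable fun x => (f x).toReal := hf.measurable.ennreal_toReal
  have hrw : ∀ ν : Measure Ω, ∫⁻ x, f x ∂ν = ∫⁻ t in Set.Ioi (0 : ℝ), ν {x | t < (f x).toReal} := by
    intro ν
    rw [← lintegral_eq_lintegral_meas_lt ν (Eventually.of_forall fun x => ENNReal.toReal_nonneg)
      hmeas.aemeasurable]
    exact lintegral_congr fun x => (ENNReal.ofReal_toReal (hfin x)).symm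
  simp_rw [hrw]
  refine le_trans (setLIntegral_mono' measurableSet_Ioi fun t ht =>
    ProbabilityMeasure.le_liminf_measure_open_of_tendsto hμ ?_) (lintegral_liminf_le fun n =>
      Antitone.measurable fun s t hst => measure_mono fun ω hω => lt_of_le_of_lt hst hω)
  convert! hf.isOpen_preimage (ENNReal.ofReal t) using 1
  ext x
  simp [ENNReal.ofReal_lt_iff_lt_toReal (le_of_lt ht) (hfin x)]

variable {X : Type*} [MetricSpace X] [CompactSpace X] [MeasurableSpace X] [BorelSpace X]

/-- The normalised counting measure of finitely many points. -/
def empiricalMeasure {Y : Type*} [MeasurableSpace Y] {N : ℕ} (q : Fin (N + 1) → Y) :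
    ProbabilityMeasure Y :=
  ⟨((N + 1 : ℕ) : ℝ≥0∞)⁻¹ • ∑ i, Measure.dirac (q i), ⟨by
    simp only [Measure.smul_apply, Measure.finsetSum_apply, measure_univ, Finset.sum_const,
      Finset.card_univ, Fintype.card_fin, nsmul_eq_mul, mul_one, smul_eq_mul]
    exact ENNReal.inv_mul_cancel (by simp) (ENNReal.natCast_ne_top _)⟩⟩

lemma lintegral_empiricalMeasure {Y : Type*} [MeasurableSpace Y] {N : ℕ} (q : Fin (N + 1) → Y)
    {f : Y → ℝ≥0∞} (hf : Measurable f) :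
    ∫⁻ x, f x ∂(empiricalMeasure q : Measure Y) =
      ((N + 1 : ℕ) : ℝ≥0∞)⁻¹ * ∑ i, f (q i) := by
  change ∫⁻ x, f x ∂(((N + 1 : ℕ) : ℝ≥0∞)⁻¹ • ∑ i, Measure.dirac (q i)) = _
  rw [lintegral_smul_measure, lintegral_finsetSum_measure]
  simp [lintegral_dirac' _ hf]

lemma lintegral_lintegral_empiricalMeasure_le {Y : Type*} [MeasurableSpace Y]
    (W V : Y → Y → ℝ≥0∞) (hW : ∀ x y, W x y = W y x)
    (hVW : ∀ x y, V x y ≤ W x y) (M : ℝ≥0∞) (hV : ∀ x y, V x y ≤ M)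
    (hVm : Measurable (Function.uncurry V)) {N : ℕ} (q : Fin (N + 1) → Y) {c : ℝ≥0∞}
    (hN : 1 ≤ N) (hc : pairSum W (N + 1) q / (((N + 1) * (N + 1 - 1) : ℕ) : ℝ≥0∞) ≤ c) :
    ∫⁻ x, ∫⁻ y, V x y ∂(empiricalMeasure q : Measure Y) ∂(empiricalMeasure q : Measure Y) ≤
      2 * c + ((N + 1 : ℕ) : ℝ≥0∞)⁻¹ * M := by
  rw [lintegral_empiricalMeasure q (Measurable.lintegral_prod_right (ν := (empiricalMeasure q : Measure Y)) hVm)]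
  simp_rw [lintegral_empiricalMeasure q (hVm.of_uncurry_left)]
  have h0 : (((N + 1) * (N + 1 - 1) : ℕ) : ℝ≥0∞) ≠ 0 := by
    have : (N + 1) * (N + 1 - 1) ≠ 0 := Nat.mul_ne_zero (by omega) (by omega)
    exact_mod_cast this
  rw [ENNReal.div_le_iff h0 (ENNReal.natCast_ne_top _)] at hc
  rw [← Finset.mul_sum]
  set n : ℝ≥0∞ := ((N + 1 : ℕ) : ℝ≥0∞) with hn
  have hn0 : n ≠ 0 := by simp [hn]
  have hnt : n ≠ ⊤ := ENNReal.natCast_ne_top _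
  have hle : (((N + 1) * (N + 1 - 1) : ℕ) : ℝ≥0∞) ≤ n * n := by
    rw [hn, ← Nat.cast_mul]
    exact_mod_cast Nat.mul_le_mul_left _ (Nat.sub_le _ _)
  calc n⁻¹ * (n⁻¹ * ∑ i, ∑ j, V (q i) (q j))
      ≤ n⁻¹ * (n⁻¹ * (2 * (c * (n * n)) + n * M)) := by
        gcongr
        refine (sum_sum_le_two_mul_pairSum W V hW hVW M hV _ q).trans ?_
        gcongr
        exact hc.trans (by gcongr)
    _ = (n⁻¹ * n) * (n⁻¹ * n) * (2 * c) + (n⁻¹ * n) * (n⁻¹ * M) := by ring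
    _ = _ := by simp [ENNReal.inv_mul_cancel hn0 hnt]

/-- Empirical measures of nearly optimal configurations accumulate at a measure whose energy is
at most the limit of the optimal configurational energies. -/
lemma exists_energy_le (W : X → X → ℝ≥0∞) (hW : ∀ x y, W x y = W y x)
    (hlsc : LowerSemicontinuous (Function.uncurry W)) {L : ℝ≥0∞} (hL : L ≠ ⊤)
    (hle : ∀ N, infPairEnergy W N ≤ L) :
    ∃ μ : ProbabilityMeasure X, ∫⁻ x, ∫⁻ y, W x y ∂(μ : Measure X) ∂(μ : Measure X) ≤ 2 * L := by
  have hq : ∀ N : ℕ, ∃ q : Fin (N + 1) → X,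
      pairSum W (N + 1) q / (((N + 1) * (N + 1 - 1) : ℕ) : ℝ≥0∞) ≤
        L + ((N + 1 : ℕ) : ℝ≥0∞)⁻¹ := by
    intro N
    have h : infPairEnergy W (N + 1) < L + ((N + 1 : ℕ) : ℝ≥0∞)⁻¹ :=
      (hle _).trans_lt (ENNReal.lt_add_right hL (by simp))
    obtain ⟨q, hq⟩ := iInf_lt_iff.1 h
    exact ⟨q, hq.le⟩
  choose q hq using hq
  obtain ⟨μ, φ, hφ, hμ⟩ := CompactSpace.tendsto_subseq fun N => empiricalMeasure (q N)
  refine ⟨μ, ?_⟩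
  have hcont := (ProbabilityMeasure.continuous_prod (α := X) (β := X)).continuousAt (x := (μ, μ))
  have hprod := hcont.tendsto.comp (hμ.prodMk_nhds hμ)
  have hinv : Tendsto (fun n => ((φ n + 1 : ℕ) : ℝ≥0∞)⁻¹) atTop (nhds 0) :=
    ENNReal.tendsto_inv_nat_nhds_zero.comp ((tendsto_add_atTop_nat 1).comp hφ.tendsto_atTop)
  have htrunc : ∀ M : ℕ,
      ∫⁻ z, min (Function.uncurry W z) M ∂((μ : Measure X).prod (μ : Measure X)) ≤ 2 * L := by
    intro M
    have hlscM : LowerSemicontinuous fun z => min (Function.uncurry W z) (M : ℝ≥0∞) :=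
      hlsc.inf lowerSemicontinuous_const
    have h1 := lintegral_le_liminf_of_lowerSemicontinuous hprod hlscM
      fun z => ne_top_of_le_ne_top (ENNReal.natCast_ne_top M) (min_le_right _ _)
    refine h1.trans ?_
    have hlim : Tendsto (fun n => 2 * (L + ((φ n + 1 : ℕ) : ℝ≥0∞)⁻¹) +
        ((φ n + 1 : ℕ) : ℝ≥0∞)⁻¹ * M) atTop (nhds (2 * L)) := by
      have := (ENNReal.Tendsto.const_mul (tendsto_const_nhds (x := L) |>.add hinv)
        (Or.inr (ENNReal.ofNat_ne_top (n := 2)))).add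
          (ENNReal.Tendsto.mul_const hinv (Or.inr (ENNReal.natCast_ne_top M)))
      simpa using this
    rw [← hlim.liminf_eq]
    refine liminf_le_liminf ?_
    filter_upwards [eventually_ge_atTop 1] with n hn
    have h2 := lintegral_lintegral_empiricalMeasure_le W (fun x y => min (W x y) M) hW
      (fun x y => min_le_left _ _) M (fun x y => min_le_right _ _) hlscM.measurable
      (q (φ n)) (hn.trans hφ.le_apply) (hq (φ n))
    refine le_trans (le_of_eq ?_) h2
    exact lintegral_prod _ hlscM.measurable.aemeasurable
  have hsup : ∀ z, Function.uncurry W z = ⨆ M : ℕ, min (Function.uncurry W z) (M : ℝ≥0∞) := by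
    intro z
    rw [← inf_iSup_eq, ENNReal.iSup_natCast, inf_top_eq]
  have hiter := lintegral_prod (μ := (μ : Measure X)) (ν := (μ : Measure X)) _
    hlsc.measurable.aemeasurable
  refine le_trans (le_of_eq hiter.symm) ?_
  rw [lintegral_congr hsup, lintegral_iSup (fun M => hlsc.measurable.min measurable_const)
    fun M M' h z => min_le_min_left _ (by exact_mod_cast h)]
  exact iSup_le htrunc

end WeakLimits

section Finiteness

variable {X : Type*} [MetricSpace X] [SecondCountableTopology X] [MeasurableSpace X] [BorelSpace X]

lemma exists_energy_lt_top (W : X → X → ℝ≥0∞) (hW : Measurable (Function.uncurry W))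
    (ν : Measure X) [IsFiniteMeasure ν] (hν : ν ≠ 0)
    (hloc : ∀ᵐ x ∂ν, ∃ r > 0, ∫⁻ y in Metric.ball x r, W x y ∂ν < ⊤) :
    ∃ μ : ProbabilityMeasure X, ∫⁻ x, ∫⁻ y, W x y ∂(μ : Measure X) ∂(μ : Measure X) < ⊤ := by
  set a : ℕ → X → ℝ≥0∞ := fun n x => ∫⁻ y in Metric.ball x (1 / (n + 1 : ℝ)), W x y ∂ν with ha
  have ham : ∀ n, Measurable (a n) := by
    intro n
    have hS : MeasurableSet {p : X × X | dist p.2 p.1 < 1 / (n + 1 : ℝ)} :=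
      (isOpen_lt (by fun_prop) (by fun_prop)).measurableSet
    have := (hW.indicator hS).lintegral_prod_right' (ν := ν)
    convert! this using 2 with x
    simp only [ha]
    rw [← lintegral_indicator Metric.isOpen_ball.measurableSet]
    rfl
  have hcov : ∃ n : ℕ, ν {x | a n x ≤ n} ≠ 0 := by
    by_contra! h
    have hU := measure_iUnion_null h
    have hall : ∀ᵐ x ∂ν, x ∈ ⋃ n : ℕ, {x | a n x ≤ n} := by
      filter_upwards [hloc] with x ⟨r, hr, hx⟩
      obtain ⟨n, hn⟩ := exists_nat_one_div_lt hr
      obtain ⟨m, hm⟩ := ENNReal.exists_nat_gt hx.ne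
      refine mem_iUnion.2 ⟨max n m, ?_⟩
      have h1 : (1 : ℝ) / ((max n m : ℕ) + 1 : ℝ) ≤ r := by
        refine le_trans ?_ hn.le
        gcongr
        exact le_max_left _ _
      calc a (max n m) x ≤ ∫⁻ y in Metric.ball x r, W x y ∂ν :=
            lintegral_mono_set (Metric.ball_subset_ball h1)
        _ ≤ m := hm.le
        _ ≤ _ := by exact_mod_cast le_max_right n m
    have : ν univ = 0 := by
      rw [← hU]
      exact (measure_congr (eventuallyEq_univ.2 hall)).symm
    exact hν (Measure.measure_univ_eq_zero.1 this)
  obtain ⟨n, hn⟩ := hcov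
  have hAm : MeasurableSet {x | a n x ≤ n} := measurableSet_le (ham n) measurable_const
  have hX : Nonempty X := by
    by_contra h
    rw [not_nonempty_iff] at h
    exact hν (Measure.eq_zero_of_isEmpty ν)
  have hball : ∃ k : ℕ, ν ({x | a n x ≤ n} ∩
      Metric.ball (TopologicalSpace.denseSeq X k) (1 / (2 * (n + 1 : ℝ)))) ≠ 0 := by
    by_contra! h
    apply hn
    rw [← measure_iUnion_null h]
    congr 1
    rw [← inter_iUnion, eq_comm, inter_eq_left]
    intro x _
    obtain ⟨k, hk⟩ := (TopologicalSpace.denseRange_denseSeq X).exists_dist_lt x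
      (ε := 1 / (2 * (n + 1 : ℝ))) (by positivity)
    exact mem_iUnion.2 ⟨k, hk⟩
  obtain ⟨k, hk⟩ := hball
  set B := {x | a n x ≤ n} ∩ Metric.ball (TopologicalSpace.denseSeq X k) (1 / (2 * (n + 1 : ℝ)))
  have hB : MeasurableSet B := hAm.inter Metric.isOpen_ball.measurableSet
  refine ⟨⟨ProbabilityTheory.cond ν B, ProbabilityTheory.cond_isProbabilityMeasure hk⟩, ?_⟩
  change ∫⁻ x, ∫⁻ y, W x y ∂((ν B)⁻¹ • ν.restrict B) ∂((ν B)⁻¹ • ν.restrict B) < ⊤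
  simp only [lintegral_smul_measure, smul_eq_mul]
  have hinv : (ν B)⁻¹ < ⊤ := ENNReal.inv_lt_top.2 (pos_iff_ne_zero.2 hk)
  refine ENNReal.mul_lt_top hinv ?_
  have hbd : ∀ x ∈ B, (ν B)⁻¹ * ∫⁻ y in B, W x y ∂ν ≤ (ν B)⁻¹ * n := by
    intro x hx
    gcongr
    refine (lintegral_mono_set fun y hy => ?_).trans hx.1
    have h1 := hx.2
    have h2 := hy.2
    rw [Metric.mem_ball] at *
    calc dist y x ≤ dist y _ + dist x _ := dist_triangle_right _ _ _
      _ < 1 / (2 * (n + 1 : ℝ)) + 1 / (2 * (n + 1 : ℝ)) := add_lt_add h2 h1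
      _ = _ := by field_simp; norm_num
  refine (setLIntegral_mono' hB hbd).trans_lt ?_
  rw [setLIntegral_const]
  exact ENNReal.mul_lt_top (ENNReal.mul_lt_top hinv (ENNReal.natCast_lt_top n)) (measure_lt_top _ _)

end Finiteness

section Euclidean

variable {D : ℕ} {Λ : Set (EucD D)} {U : EucD D → EucD D → ℝ≥0∞}

/-- The interaction restricted to the closure of the domain. -/
def restrictClosure (U : EucD D → EucD D → ℝ≥0∞) (Λ : Set (EucD D)) :
    closure Λ → closure Λ → ℝ≥0∞ :=
  fun x y => U x y

lemma lowerSemicontinuous_restrictClosure (hU : HypUE D U Λ) :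
    LowerSemicontinuous (Function.uncurry (restrictClosure U Λ)) := by
  intro z a ha
  have h := hU.lsc (z.1.1, z.2.1) ⟨z.1.2, z.2.2⟩ a ha
  have ht : Tendsto (fun z : closure Λ × closure Λ => ((z.1 : EucD D), (z.2 : EucD D))) (nhds z)
      (nhdsWithin (z.1.1, z.2.1) (closure Λ ×ˢ closure Λ)) :=
    tendsto_nhdsWithin_iff.2 ⟨Continuous.tendsto (by fun_prop) z,
      Eventually.of_forall fun w => ⟨w.1.2, w.2.2⟩⟩
  exact ht.eventually h

lemma pairGroundEnergy_eq_infPairEnergy (N : ℕ) :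
    pairGroundEnergy D U Λ N = infPairEnergy (restrictClosure U Λ) N := by
  refine le_antisymm (le_iInf fun q => ?_) (le_iInf₂ fun q hq => ?_)
  · exact iInf₂_le (fun i => (q i : EucD D)) fun i => (q i).2
  · exact iInf_le _ fun i => (⟨q i, hq i⟩ : closure Λ)

lemma pairingE_map_val (μ : Measure (closure Λ)) :
    pairingE D U (μ.map Subtype.val) (μ.map Subtype.val) =
      (∫⁻ x, ∫⁻ y, restrictClosure U Λ x y ∂μ ∂μ) / 2 := by
  have he : MeasurableEmbedding (Subtype.val : closure Λ → EucD D) :=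
    MeasurableEmbedding.subtype_coe isClosed_closure.measurableSet
  unfold pairingE
  rw [he.lintegral_map]
  simp_rw [he.lintegral_map, div_eq_mul_inv]
  have h2 : (2 : ℝ≥0∞)⁻¹ ≠ ⊤ := by simp
  simp_rw [lintegral_mul_const' _ _ h2]
  rfl

lemma isProbOn_map_val (μ : ProbabilityMeasure (closure Λ)) :
    IsProbOn D Λ ((μ : Measure (closure Λ)).map Subtype.val) := by
  refine ⟨Measure.isProbabilityMeasure_map measurable_subtype_coe.aemeasurable, ?_⟩
  rw [Measure.map_apply measurable_subtype_coe isClosed_closure.measurableSet.compl]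
  simp

lemma IsProbOn.exists_map_val {ρ : Measure (EucD D)} (hρ : IsProbOn D Λ ρ) :
    ∃ μ : ProbabilityMeasure (closure Λ), (μ : Measure (closure Λ)).map Subtype.val = ρ := by
  obtain ⟨hprob, h0⟩ := hρ
  have hK : MeasurableSet (closure Λ) := isClosed_closure.measurableSet
  have hmap : (ρ.comap (Subtype.val : closure Λ → EucD D)).map Subtype.val = ρ := by
    rw [map_comap_subtype_coe hK, Measure.restrict_eq_self_of_ae_mem]
    exact h0
  refine ⟨⟨ρ.comap Subtype.val, ⟨?_⟩⟩, hmap⟩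
  have := measure_univ (μ := ρ)
  rw [← hmap, Measure.map_apply measurable_subtype_coe MeasurableSet.univ, preimage_univ] at this
  exact this

lemma exists_restrictClosure_energy_lt_top (hΛne : Λ.Nonempty) (hΛopen : IsOpen Λ)
    (hΛbdd : Bornology.IsBounded Λ) (hU : HypUE D U Λ) :
    ∃ μ : ProbabilityMeasure (closure Λ),
      ∫⁻ x, ∫⁻ y, restrictClosure U Λ x y ∂(μ : Measure (closure Λ)) ∂(μ : Measure (closure Λ))
        < ⊤ := by
  have hK : MeasurableSet (closure Λ) := isClosed_closure.measurableSet
  have he : MeasurableEmbedding (Subtype.val : closure Λ → EucD D) :=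
    MeasurableEmbedding.subtype_coe hK
  set ν : Measure (closure Λ) :=
    (volume.comap (Subtype.val : closure Λ → EucD D)).restrict (Subtype.val ⁻¹' Λ) with hν
  have hmap : ν.map Subtype.val = (volume : Measure (EucD D)).restrict Λ := by
    rw [hν, ← he.restrict_map, map_comap_subtype_coe hK,
      Measure.restrict_restrict hΛopen.measurableSet, inter_eq_left.2 subset_closure]
  have huniv : ν univ = volume Λ := by
    have : (ν.map Subtype.val) univ = volume Λ := by rw [hmap, Measure.restrict_apply_univ]
    rwa [Measure.map_apply measurable_subtype_coe MeasurableSet.univ, preimage_univ] at this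
  have hfin : IsFiniteMeasure ν := ⟨by rw [huniv]; exact hΛbdd.measure_lt_top⟩
  have hne : ν ≠ 0 := by
    intro h
    rw [h, Measure.coe_zero, Pi.zero_apply] at huniv
    exact (hΛopen.measure_pos volume hΛne).ne huniv
  refine exists_energy_lt_top _ (lowerSemicontinuous_restrictClosure hU).measurable ν hne ?_
  have hmem : ∀ᵐ x ∂ν, x ∈ (Subtype.val ⁻¹' Λ : Set (closure Λ)) :=
    ae_restrict_mem (measurable_subtype_coe hΛopen.measurableSet)
  filter_upwards [hmem] with x hx
  obtain ⟨r, hr, hr2⟩ := hU.locL2 x hx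
  refine ⟨r, hr, ?_⟩
  have heq : ∫⁻ y in Metric.ball x r, restrictClosure U Λ x y ∂ν =
      ∫⁻ y in Metric.ball (x : EucD D) r ∩ Λ, U x y := by
    rw [← Measure.restrict_restrict Metric.isOpen_ball.measurableSet, ← hmap, he.restrict_map,
      he.lintegral_map]
    rfl
  rw [heq]
  have hle : ∀ t : ℝ≥0∞, t ≤ 1 + t ^ 2 := by
    intro t
    rcases le_total t 1 with h | h
    · exact h.trans le_self_add
    · exact (le_self_pow₀ h two_ne_zero).trans le_add_self
  refine (lintegral_mono fun y => hle (U x y)).trans_lt ?_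
  rw [lintegral_add_left measurable_const, setLIntegral_const, one_mul]
  exact ENNReal.add_lt_top.2
    ⟨(measure_mono inter_subset_right).trans_lt hΛbdd.measure_lt_top, hr2⟩

end Euclidean

theorem statement16
    (Λ : Set (EucD D)) (hΛne : Λ.Nonempty) (hΛopen : IsOpen Λ)
    (hΛbdd : Bornology.IsBounded Λ) (hΛconn : IsConnected Λ)
    (U : EucD D → EucD D → ℝ≥0∞) (hU : HypUE D U Λ) :
    (∀ N : ℕ, 2 ≤ N → pairGroundEnergy D U Λ N ≤ pairGroundEnergy D U Λ (N + 1)) ∧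
    (∃ ρ₀ : Measure (EucD D), IsProbOn D Λ ρ₀ ∧
      pairingE D U ρ₀ ρ₀ = groundEnergyE D U Λ) ∧
    groundEnergyE D U Λ < ⊤ ∧
    Tendsto (fun N : ℕ => pairGroundEnergy D U Λ N) atTop (nhds (groundEnergyE D U Λ)) := by

  set W := restrictClosure U Λ
  have hlsc : LowerSemicontinuous (Function.uncurry W) := lowerSemicontinuous_restrictClosure hU
  have hne : Nonempty (closure Λ) := hΛne.closure.to_subtype
  have hcpt : CompactSpace (closure Λ) := isCompact_iff_compactSpace.1 hΛbdd.isCompact_closure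
  have hmono := infPairEnergy_monotone W
  have hground_le : ∀ μ : ProbabilityMeasure (closure Λ), groundEnergyE D U Λ ≤
      (∫⁻ x, ∫⁻ y, W x y ∂(μ : Measure (closure Λ)) ∂(μ : Measure (closure Λ))) / 2 := fun μ => by
    rw [← pairingE_map_val]
    exact iInf₂_le _ (isProbOn_map_val μ)
  have hle_ground : ∀ N, infPairEnergy W N ≤ groundEnergyE D U Λ := by
    intro N
    refine (hmono (le_max_left N 2)).trans (le_iInf₂ fun ρ hρ => ?_)
    obtain ⟨μ, rfl⟩ := IsProbOn.exists_map_val hρ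
    rw [pairingE_map_val]
    exact infPairEnergy_le_lintegral W hlsc.measurable μ (le_max_right _ _)
  have hfin : groundEnergyE D U Λ < ⊤ := by
    obtain ⟨μ, hμ⟩ := exists_restrictClosure_energy_lt_top hΛne hΛopen hΛbdd hU
    exact (hground_le μ).trans_lt (ENNReal.div_lt_top hμ.ne two_ne_zero)
  have hsup_le : ⨆ N, infPairEnergy W N ≤ groundEnergyE D U Λ := iSup_le hle_ground
  obtain ⟨μ, hμ⟩ := exists_energy_le W (fun x y => hU.symm x x.2 y y.2) hlsc
    (ne_top_of_le_ne_top hfin.ne hsup_le) (le_iSup _)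
  have hμ' : (∫⁻ x, ∫⁻ y, W x y ∂(μ : Measure (closure Λ)) ∂(μ : Measure (closure Λ))) / 2 ≤
      ⨆ N, infPairEnergy W N :=
    ENNReal.div_le_of_le_mul (by rwa [mul_comm])
  have hsup : ⨆ N, infPairEnergy W N = groundEnergyE D U Λ :=
    le_antisymm hsup_le ((hground_le μ).trans hμ')
  simp_rw [pairGroundEnergy_eq_infPairEnergy]
  refine ⟨fun N _ => hmono N.le_succ, ⟨_, isProbOn_map_val μ, ?_⟩, hfin, ?_⟩
  · rw [pairingE_map_val]
    exact le_antisymm (hμ'.trans hsup_le) (hground_le μ)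
  · rw [← hsup]
    exact tendsto_atTop_iSup hmono
end
end

section
/- Let Λ ⊂ ℝ^D be a nonempty bounded connected open set and assume hypotheses (H1)–(H4) on U. For each N ≥ 2 let X_g^{(N)} = (q₁^g,…,q_N^g) ∈ cl(Λ)^N be a minimizer of I_N(q) = Σ_{1≤i<j≤N} U(q_i,q_j) over cl(Λ)^N, and let Δ²_N := (N(N−1))⁻¹·Σ_{i≠j} δ_{(q_i^g, q_j^g)} be the associated empirical 2-point measure on cl(Λ)². Then every weak limit point μ of the sequence (Δ²_N)_{N≥2} is a product measure: μ = ρ̇⊗ρ̇ for some Borel probability measure ρ̇ on cl(Λ), and ρ̇ minimizes the bilinear form, i.e. ⟨ρ̇,ρ̇⟩ = ε_g := min{ ⟨ρ,ρ⟩ : ρ a Borel probability measure on cl(Λ) }. -/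
open MeasureTheory Real Filter Set
open scoped BigOperators ENNReal

noncomputable section

variable (D : ℕ)

/-- The empirical 2-point measure `Δ²_N = (N(N−1))⁻¹ ∑_{i≠j} δ_{(q_i,q_j)}`
of a configuration. -/
def emp2 (N : ℕ) (q : Fin N → EucD D) : Measure (EucD D × EucD D) :=
  (((N * (N - 1) : ℕ) : ℝ≥0∞))⁻¹ •
    ∑ i : Fin N, ∑ j : Fin N,
      if i ≠ j then Measure.dirac (q i, q j) else 0

/-- For a lower semicontinuous `f ≥ 0`, the functional `ν ↦ ∫⁻ f dν` is sequentially lower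
semicontinuous for weak convergence of probability measures. -/
lemma LowerSemicontinuous.lintegral_le_liminf {Ω : Type*} [TopologicalSpace Ω]
    [MeasurableSpace Ω] [BorelSpace Ω] {f : Ω → ℝ≥0∞} (hf : LowerSemicontinuous f)
    {μ : Measure Ω} {μs : ℕ → Measure Ω}
    (h_opens : ∀ G, IsOpen G → μ G ≤ atTop.liminf (fun i ↦ μs i G)) :
    ∫⁻ x, f x ∂μ ≤ atTop.liminf (fun i ↦ ∫⁻ x, f x ∂(μs i)) := by
  have hmeas : Measurable f := hf.measurable
  have hsup : ∀ x, f x = ⨆ n : ℕ, min (f x) n := fun x ↦ by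
    rw [← inf_iSup_eq, ENNReal.iSup_natCast, inf_top_eq]
  calc ∫⁻ x, f x ∂μ = ∫⁻ x, ⨆ n : ℕ, min (f x) n ∂μ := lintegral_congr hsup
    _ = ⨆ n : ℕ, ∫⁻ x, min (f x) n ∂μ := by
      refine lintegral_iSup (fun n ↦ hmeas.min measurable_const) fun m n hmn x ↦ ?_
      exact min_le_min le_rfl (by exact_mod_cast hmn)
    _ ≤ _ := iSup_le fun n ↦ ?_
  have hne : ∀ x, min (f x) n ≠ ∞ := fun x ↦ (min_lt_of_right_lt (ENNReal.natCast_lt_top n)).ne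
  have key : ∀ ν : Measure Ω, ∫⁻ x, min (f x) n ∂ν =
      ∫⁻ t in Ioi (0 : ℝ), ν {x | t < (min (f x) n).toReal} := fun ν ↦ by
    rw [← lintegral_eq_lintegral_meas_lt ν (Eventually.of_forall fun _ ↦ ENNReal.toReal_nonneg)
      (hmeas.min measurable_const).ennreal_toReal.aemeasurable]
    exact lintegral_congr fun x ↦ (ENNReal.ofReal_toReal (hne x)).symm
  calc ∫⁻ x, min (f x) n ∂μ
      ≤ ∫⁻ t in Ioi (0 : ℝ), atTop.liminf fun i ↦ μs i {x | t < (min (f x) n).toReal} := by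
        rw [key]
        refine setLIntegral_mono' measurableSet_Ioi fun t ht ↦ h_opens _ ?_
        have : {x | t < (min (f x) n).toReal}
            = (fun x ↦ f x) ⁻¹' Ioi (ENNReal.ofReal t) ∩ {_x | ENNReal.ofReal t < n} := by
          ext x
          simp [← ENNReal.ofReal_lt_iff_lt_toReal (le_of_lt ht) (hne x)]
        rw [this]
        exact (hf.isOpen_preimage _).inter isOpen_const
    _ ≤ atTop.liminf fun i ↦ ∫⁻ t in Ioi (0 : ℝ), μs i {x | t < (min (f x) n).toReal} :=
        lintegral_liminf_le fun i ↦ Antitone.measurable fun s t hst ↦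
          measure_mono fun x hx ↦ lt_of_le_of_lt hst hx
    _ ≤ _ := by
        simp_rw [← key]
        exact liminf_le_liminf (Eventually.of_forall fun i ↦
          lintegral_mono fun x ↦ min_le_left _ _)

/-- Extending a function that is lower semicontinuous on a closed set by `∞` keeps it lower
semicontinuous. -/
lemma LowerSemicontinuousOn.lowerSemicontinuous_extend_top {X : Type*} [TopologicalSpace X]
    {f : X → ℝ≥0∞} {s : Set X} [DecidablePred (· ∈ s)] (hf : LowerSemicontinuousOn f s)
    (hs : IsClosed s) : LowerSemicontinuous fun x ↦ if x ∈ s then f x else ∞ := by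
  intro x y hy
  by_cases hx : x ∈ s
  · have := hf x hx y (by simpa [hx] using hy)
    filter_upwards [eventually_nhdsWithin_iff.mp this] with z hz
    split_ifs with h
    exacts [hz h, lt_of_lt_of_le hy le_top]
  · filter_upwards [hs.isOpen_compl.mem_nhds hx] with z hz
    rw [if_neg hz]
    exact lt_of_lt_of_le hy le_top

section EmpiricalMeasure

variable {D}

lemma lintegral_emp2 {N : ℕ} (q : Fin N → EucD D) {f : EucD D × EucD D → ℝ≥0∞} :
    ∫⁻ p, f p ∂(emp2 D N q) = ((N * (N - 1) : ℕ) : ℝ≥0∞)⁻¹ *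
      ∑ i : Fin N, ∑ j : Fin N, if i ≠ j then f (q i, q j) else 0 := by
  simp only [emp2, lintegral_smul_measure, lintegral_finsetSum_measure, smul_eq_mul]
  congr! 3 with i _ j _
  split_ifs <;> simp

lemma integral_emp2 {N : ℕ} (q : Fin N → EucD D) {f : EucD D × EucD D → ℝ} :
    ∫ p, f p ∂(emp2 D N q) = ((N * (N - 1) : ℕ) : ℝ)⁻¹ *
      ∑ i : Fin N, ∑ j : Fin N, if i ≠ j then f (q i, q j) else 0 := by
  have hint : ∀ i j : Fin N,
      Integrable f (if i ≠ j then Measure.dirac (q i, q j) else 0) := fun i j ↦ by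
    split_ifs
    exacts [integrable_dirac (by simp), integrable_zero_measure]
  rw [emp2, integral_smul_measure, ENNReal.toReal_inv, ENNReal.toReal_natCast, smul_eq_mul,
    integral_finsetSum_measure fun i _ ↦ integrable_finsetSum_measure.2 fun j _ ↦ hint i j]
  congr 1
  refine Finset.sum_congr rfl fun i _ ↦ ?_
  rw [integral_finsetSum_measure fun j _ ↦ hint i j]
  refine Finset.sum_congr rfl fun j _ ↦ ?_
  split_ifs <;> simp

lemma sum_sum_ne_const {R : Type*} [CommSemiring R] (N : ℕ) (c : R) :
    ∑ i : Fin N, ∑ j : Fin N, (if i ≠ j then c else 0) = ((N * (N - 1) : ℕ) : R) * c := by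
  have : ∀ i : Fin N, ∑ j : Fin N, (if i ≠ j then c else 0) = ((N - 1 : ℕ) : R) * c := fun i ↦ by
    rw [← Finset.sum_filter, Finset.sum_const, Finset.filter_ne, Finset.card_erase_of_mem (by simp)]
    simp
  simp only [this, Finset.sum_const, Finset.card_univ, Fintype.card_fin, nsmul_eq_mul, Nat.cast_mul,
    mul_assoc]

lemma inv_natCast_mul_pred_mul_cancel {N : ℕ} (hN : 2 ≤ N) (c : ℝ≥0∞) :
    ((N * (N - 1) : ℕ) : ℝ≥0∞)⁻¹ * (((N * (N - 1) : ℕ) : ℝ≥0∞) * c) = c := by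
  have h : N * (N - 1) ≠ 0 := mul_ne_zero (by omega) (by omega)
  rw [← mul_assoc, ENNReal.inv_mul_cancel (by exact_mod_cast h) (ENNReal.natCast_ne_top _), one_mul]

lemma isProbabilityMeasure_emp2 {N : ℕ} (hN : 2 ≤ N) (q : Fin N → EucD D) :
    IsProbabilityMeasure (emp2 D N q) := by
  refine ⟨?_⟩
  rw [← lintegral_one, lintegral_emp2, sum_sum_ne_const, inv_natCast_mul_pred_mul_cancel hN]

lemma emp2_apply_eq_zero {N : ℕ} {q : Fin N → EucD D} {s : Set (EucD D × EucD D)}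
    (hs : MeasurableSet s) (h : ∀ i j, (q i, q j) ∉ s) : emp2 D N q s = 0 := by
  rw [← lintegral_indicator_one hs, lintegral_emp2]
  simp [h]

/-- The integral of a product function against the empirical 2-point measure differs from the
product of the integrals of its factors by the (vanishing) diagonal contribution. -/
lemma abs_integral_emp2_mul_sub_le {N : ℕ} (hN : 2 ≤ N) (q : Fin N → EucD D)
    {f g : EucD D → ℝ} {A B : ℝ} (hf : ∀ x, |f x| ≤ A) (hg : ∀ x, |g x| ≤ B) :
    |∫ p, f p.1 * g p.2 ∂(emp2 D N q)
      - (∫ p, f p.1 ∂(emp2 D N q)) * ∫ p, g p.1 ∂(emp2 D N q)|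
      ≤ 2 * A * B / ((N : ℝ) - 1) := by
  have hN' : (2 : ℝ) ≤ N := by exact_mod_cast hN
  have hN0 : (0 : ℝ) < N := by linarith
  have hN1 : (0 : ℝ) < (N : ℝ) - 1 := by linarith
  have hcast : ((N * (N - 1) : ℕ) : ℝ) = N * ((N : ℝ) - 1) := by
    rw [Nat.cast_mul, Nat.cast_sub (by omega), Nat.cast_one]
  have hmarg : ∀ u : EucD D → ℝ,
      ∫ p, u p.1 ∂(emp2 D N q) = (N : ℝ)⁻¹ * ∑ i, u (q i) := fun u ↦ by
    have : ∀ i : Fin N, ∑ j : Fin N, (if i ≠ j then u (q i) else 0)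
        = ((N : ℝ) - 1) * u (q i) := fun i ↦ by
      rw [← Finset.sum_filter, Finset.sum_const, Finset.filter_ne,
        Finset.card_erase_of_mem (by simp), nsmul_eq_mul, Finset.card_univ, Fintype.card_fin,
        Nat.cast_sub (by omega), Nat.cast_one]
    rw [integral_emp2, hcast]
    simp only [this, ← Finset.mul_sum]
    field_simp
  have hprod : ∫ p, f p.1 * g p.2 ∂(emp2 D N q) = ((N : ℝ) * ((N : ℝ) - 1))⁻¹ *
      ((∑ i, f (q i)) * (∑ i, g (q i)) - ∑ i, f (q i) * g (q i)) := by
    rw [integral_emp2, hcast, Finset.sum_mul_sum, ← Finset.sum_sub_distrib]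
    congr 1
    refine Finset.sum_congr rfl fun i _ ↦ ?_
    rw [eq_sub_iff_add_eq, ← Finset.sum_erase_add _ _ (Finset.mem_univ i)]
    conv_rhs => rw [← Finset.sum_erase_add _ _ (Finset.mem_univ i)]
    simp only [ne_eq, not_true_eq_false, if_false, add_zero]
    congr 1
    refine Finset.sum_congr rfl fun j hj ↦ ?_
    rw [if_pos (Finset.ne_of_mem_erase hj).symm]
  have hbound : ∀ {u : EucD D → ℝ} {C : ℝ}, (∀ x, |u x| ≤ C) → |∑ i, u (q i)| ≤ N * C :=
    fun {u C} hu ↦ by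
      calc |∑ i, u (q i)| ≤ ∑ i, |u (q i)| := Finset.abs_sum_le_sum_abs _ _
        _ ≤ ∑ _i : Fin N, C := Finset.sum_le_sum fun i _ ↦ hu _
        _ = N * C := by simp
  have hA : 0 ≤ A := (abs_nonneg _).trans (hf 0)
  have hfg : |∑ i, f (q i) * g (q i)| ≤ N * (A * B) :=
    hbound (u := fun x ↦ f x * g x) fun x ↦ by
      rw [abs_mul]
      exact mul_le_mul (hf x) (hg x) (abs_nonneg _) hA
  have hff : |(∑ i, f (q i)) * (∑ i, g (q i))| ≤ (N * A) * (N * B) := by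
    rw [abs_mul]
    exact mul_le_mul (hbound hf) (hbound hg) (abs_nonneg _) (by positivity)
  rw [hprod, hmarg, hmarg]
  set F := ∑ i, f (q i)
  set G := ∑ i, g (q i)
  set H := ∑ i, f (q i) * g (q i)
  have : ((N : ℝ) * ((N : ℝ) - 1))⁻¹ * (F * G - H) - (N : ℝ)⁻¹ * F * ((N : ℝ)⁻¹ * G)
      = (F * G / N - H) / (N * ((N : ℝ) - 1)) := by
    field_simp
    ring
  rw [this, abs_div, abs_of_pos (mul_pos hN0 hN1), div_le_div_iff₀ (mul_pos hN0 hN1) hN1]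
  have h1 : |F * G / N| ≤ N * (A * B) := by
    rw [abs_div, abs_of_pos hN0, div_le_iff₀ hN0]
    linarith
  have h2 : |F * G / N - H| ≤ 2 * (N * (A * B)) := (abs_sub _ _).trans (by linarith)
  calc |F * G / N - H| * ((N : ℝ) - 1) ≤ 2 * (N * (A * B)) * ((N : ℝ) - 1) :=
        mul_le_mul_of_nonneg_right h2 hN1.le
    _ = _ := by ring

/-- Weak limits of empirical 2-point measures of configurations of unbounded size are product
measures. -/
lemma eq_prod_of_tendsto_emp2 {N : ℕ → ℕ} (hN : Tendsto N atTop atTop)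
    {q : (j : ℕ) → Fin (N j) → EucD D} {μ : Measure (EucD D × EucD D)} [IsProbabilityMeasure μ]
    (hconv : ∀ h : BoundedContinuousFunction (EucD D × EucD D) ℝ,
      Tendsto (fun j ↦ ∫ p, h p ∂(emp2 D (N j) (q j))) atTop (nhds (∫ p, h p ∂μ))) :
    μ = (μ.map Prod.fst).prod (μ.map Prod.fst) := by
  have : IsProbabilityMeasure (μ.map Prod.fst) :=
    Measure.isProbabilityMeasure_map measurable_fst.aemeasurable
  refine Measure.eq_prod_of_integral_mul_boundedContinuousFunction fun f g ↦ ?_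
  rw [integral_map measurable_fst.aemeasurable f.continuous.aestronglyMeasurable,
    integral_map measurable_fst.aemeasurable g.continuous.aestronglyMeasurable]
  have hf := hconv (f.compContinuous ⟨Prod.fst, continuous_fst⟩)
  have hg := hconv (g.compContinuous ⟨Prod.fst, continuous_fst⟩)
  have hfg := hconv (f.compContinuous ⟨Prod.fst, continuous_fst⟩
    * g.compContinuous ⟨Prod.snd, continuous_snd⟩)
  simp only [BoundedContinuousFunction.coe_mul, Pi.mul_apply,
    BoundedContinuousFunction.compContinuous_apply, ContinuousMap.coe_mk] at hf hg hfg
  refine sub_eq_zero.1 (tendsto_nhds_unique (hfg.sub (hf.mul hg)) ?_)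
  have hlim : Tendsto (fun j ↦ 2 * ‖f‖ * ‖g‖ / ((N j : ℝ) - 1)) atTop (nhds 0) :=
    (tendsto_atTop_add_const_right _ (-1)
      (tendsto_natCast_atTop_atTop.comp hN)).const_div_atTop _
  refine squeeze_zero_norm' ?_ hlim
  filter_upwards [hN.eventually_ge_atTop 2] with j hj
  exact abs_integral_emp2_mul_sub_le hj (q j) f.norm_coe_le_norm g.norm_coe_le_norm

/-- The pair interaction, extended by `∞` outside `cl(Λ) × cl(Λ)`. -/
def extendedInteraction (U : EucD D → EucD D → ℝ≥0∞) (Λ : Set (EucD D))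
    (p : EucD D × EucD D) : ℝ≥0∞ :=
  open Classical in if p ∈ closure Λ ×ˢ closure Λ then U p.1 p.2 else ∞

section Interaction

variable {U : EucD D → EucD D → ℝ≥0∞} {Λ : Set (EucD D)}

lemma extendedInteraction_of_mem {x y : EucD D} (hx : x ∈ closure Λ) (hy : y ∈ closure Λ) :
    extendedInteraction U Λ (x, y) = U x y := if_pos ⟨hx, hy⟩

lemma HypUE.lowerSemicontinuous_extendedInteraction (hU : HypUE D U Λ) :
    LowerSemicontinuous (extendedInteraction U Λ) := by
  classical
  convert! hU.lsc.lowerSemicontinuous_extend_top (isClosed_closure.prod isClosed_closure)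

lemma HypUE.measurable_extendedInteraction (hU : HypUE D U Λ) :
    Measurable (extendedInteraction U Λ) :=
  hU.lowerSemicontinuous_extendedInteraction.measurable

lemma IsProbOn.ae_mem {ρ : Measure (EucD D)} (hρ : IsProbOn D Λ ρ) : ∀ᵐ x ∂ρ, x ∈ closure Λ :=
  hρ.2

lemma HypUE.pairingE_eq (hU : HypUE D U Λ) {ρ : Measure (EucD D)} (hρ : IsProbOn D Λ ρ) :
    pairingE D U ρ ρ = ∫⁻ p, extendedInteraction U Λ p / 2 ∂(ρ.prod ρ) := by
  have := hρ.1
  rw [lintegral_prod _ (hU.measurable_extendedInteraction.div_const 2).aemeasurable]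
  refine lintegral_congr_ae ?_
  filter_upwards [hρ.ae_mem] with x hx
  refine lintegral_congr_ae ?_
  filter_upwards [hρ.ae_mem] with y hy
  rw [extendedInteraction_of_mem hx hy]

lemma HypUE.lintegral_emp2_eq (hU : HypUE D U Λ) {N : ℕ} {q : Fin N → EucD D}
    (hq : ∀ i, q i ∈ closure Λ) :
    ∫⁻ p, extendedInteraction U Λ p / 2 ∂(emp2 D N q)
      = ((N * (N - 1) : ℕ) : ℝ≥0∞)⁻¹ * interactionE D U N q := by
  rw [lintegral_emp2]
  congr 1
  have hsplit : ∀ i j : Fin N,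
      (if i ≠ j then extendedInteraction U Λ (q i, q j) / 2 else 0)
        = (if (i : ℕ) < j then U (q i) (q j) / 2 else 0)
          + (if (j : ℕ) < i then U (q j) (q i) / 2 else 0) := fun i j ↦ by
    rw [extendedInteraction_of_mem (hq i) (hq j)]
    rcases lt_trichotomy (i : ℕ) j with h | h | h
    · simp [h, h.not_gt, Fin.ne_of_lt h]
    · simp [Fin.ext h]
    · simp [h, h.not_gt, Fin.ne_of_gt h, hU.symm _ (hq i) _ (hq j)]
  simp only [hsplit, Finset.sum_add_distrib]
  rw [Finset.sum_comm (f := fun i j : Fin N ↦ if (j : ℕ) < i then U (q j) (q i) / 2 else 0),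
    ← Finset.sum_add_distrib, interactionE]
  refine Finset.sum_congr rfl fun i _ ↦ ?_
  rw [← Finset.sum_add_distrib]
  refine Finset.sum_congr rfl fun j _ ↦ ?_
  split_ifs
  exacts [ENNReal.add_halves _, add_zero _]

/-- Averaging over independent particles: some configuration in `cl(Λ)` has mean energy per pair
at most `⟨ρ,ρ⟩`. -/
lemma HypUE.exists_interactionE_le (hU : HypUE D U Λ) {ρ : Measure (EucD D)}
    (hρ : IsProbOn D Λ ρ) {N : ℕ} (hN : 2 ≤ N) :
    ∃ q : Fin N → EucD D, (∀ i, q i ∈ closure Λ) ∧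
      ((N * (N - 1) : ℕ) : ℝ≥0∞)⁻¹ * interactionE D U N q ≤ pairingE D U ρ ρ := by
  have := hρ.1
  have hV : Measurable fun p ↦ extendedInteraction U Λ p / 2 :=
    hU.measurable_extendedInteraction.div_const 2
  set P : Measure (Fin N → EucD D) := Measure.pi fun _ ↦ ρ
  have hpair : ∀ i j : Fin N, i ≠ j →
      ∫⁻ q, extendedInteraction U Λ (q i, q j) / 2 ∂P = pairingE D U ρ ρ := fun i j hij ↦ by
    have hind : ProbabilityTheory.IndepFun (fun q : Fin N → EucD D ↦ q i) (fun q ↦ q j) P :=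
      (ProbabilityTheory.iIndepFun_pi (X := fun _ ↦ id) fun _ ↦ aemeasurable_id).indepFun hij
    have hlaw : P.map (fun q ↦ (q i, q j)) = ρ.prod ρ := by
      rw [(ProbabilityTheory.indepFun_iff_map_prod_eq_prod_map_map
        (measurable_pi_apply i).aemeasurable (measurable_pi_apply j).aemeasurable).1 hind]
      congr 1
      exacts [(measurePreserving_eval (fun _ ↦ ρ) i).map_eq,
        (measurePreserving_eval (fun _ ↦ ρ) j).map_eq]
    rw [hU.pairingE_eq hρ, ← hlaw, lintegral_map hV (by fun_prop)]
  have hmeas : ∀ i j : Fin N, Measurable fun q : Fin N → EucD D ↦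
      if i ≠ j then extendedInteraction U Λ (q i, q j) / 2 else 0 := fun i j ↦ by
    split_ifs
    exacts [hV.comp (by fun_prop), measurable_const]
  have havg : ∫⁻ q, ∫⁻ p, extendedInteraction U Λ p / 2 ∂(emp2 D N q) ∂P = pairingE D U ρ ρ := by
    simp only [lintegral_emp2]
    rw [lintegral_const_mul _ (Finset.measurable_sum _ fun i _ ↦
        Finset.measurable_sum _ fun j _ ↦ hmeas i j),
      lintegral_finsetSum _ fun i _ ↦ Finset.measurable_sum _ fun j _ ↦ hmeas i j]
    have : ∀ i : Fin N, ∫⁻ q, ∑ j : Fin N,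
        (if i ≠ j then extendedInteraction U Λ (q i, q j) / 2 else 0) ∂P
          = ∑ j : Fin N, if i ≠ j then pairingE D U ρ ρ else 0 := fun i ↦ by
      rw [lintegral_finsetSum _ fun j _ ↦ hmeas i j]
      refine Finset.sum_congr rfl fun j _ ↦ ?_
      split_ifs with h
      exacts [hpair i j h, lintegral_zero]
    simp only [this]
    rw [sum_sum_ne_const, inv_natCast_mul_pred_mul_cancel hN]
  have hmem : ∀ᵐ q ∂P, ∀ i, q i ∈ closure Λ := ae_all_iff.2 fun i ↦
    (measurePreserving_eval (fun _ ↦ ρ) i).quasiMeasurePreserving.ae hρ.ae_mem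
  have haemeas : AEMeasurable
      (fun q ↦ ∫⁻ p, extendedInteraction U Λ p / 2 ∂(emp2 D N q)) P := by
    simp only [lintegral_emp2]
    exact ((Finset.measurable_sum _ fun i _ ↦ Finset.measurable_sum _ fun j _ ↦
      hmeas i j).const_mul _).aemeasurable
  obtain ⟨q, hq, hle⟩ := exists_notMem_null_le_lintegral haemeas hmem
  simp only [mem_ofPred_eq, mem_compl_iff, not_not] at hq
  exact ⟨q, hq, by rwa [← hU.lintegral_emp2_eq hq, ← havg]⟩

end Interaction

end EmpiricalMeasure

theorem statement18
    (Λ : Set (EucD D)) (hΛne : Λ.Nonempty) (hΛopen : IsOpen Λ)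
    (hΛbdd : Bornology.IsBounded Λ) (hΛconn : IsConnected Λ)
    (U : EucD D → EucD D → ℝ≥0∞) (hU : HypUE D U Λ)
    -- a family of ground state configurations
    (Xg : (N : ℕ) → Fin N → EucD D)
    (hXg : ∀ N : ℕ, 2 ≤ N → (∀ i, Xg N i ∈ closure Λ) ∧
      ∀ q : Fin N → EucD D, (∀ i, q i ∈ closure Λ) →
        interactionE D U N (Xg N) ≤ interactionE D U N q)
    -- a weak limit point `μ` of the empirical 2-point measures along a subsequence
    (μ : Measure (EucD D × EucD D)) (hμprob : IsProbabilityMeasure μ)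
    (φ : ℕ → ℕ) (hφ : StrictMono φ) (hφ2 : ∀ j, 2 ≤ φ j)
    (hconv : ∀ h : BoundedContinuousFunction (EucD D × EucD D) ℝ,
      Tendsto (fun j : ℕ => ∫ p, h p ∂(emp2 D (φ j) (Xg (φ j))))
        atTop (nhds (∫ p, h p ∂μ))) :
    ∃ ρ : Measure (EucD D), IsProbOn D Λ ρ ∧ μ = ρ.prod ρ ∧
      pairingE D U ρ ρ = groundEnergyE D U Λ := by

  have hE : ∀ j, IsProbabilityMeasure (emp2 D (φ j) (Xg (φ j))) := fun j ↦
    isProbabilityMeasure_emp2 (hφ2 j) _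
  have hopens : ∀ G, IsOpen G → μ G ≤ atTop.liminf fun j ↦ emp2 D (φ j) (Xg (φ j)) G :=
    fun G hG ↦ ProbabilityMeasure.le_liminf_measure_open_of_tendsto
      (μ := ⟨μ, hμprob⟩) (μs := fun j ↦ ⟨emp2 D (φ j) (Xg (φ j)), hE j⟩)
      (ProbabilityMeasure.tendsto_iff_forall_integral_tendsto.2 hconv) hG
  have hprod := eq_prod_of_tendsto_emp2 hφ.tendsto_atTop hconv
  have hρ : IsProbOn D Λ (μ.map Prod.fst) := by
    refine ⟨Measure.isProbabilityMeasure_map measurable_fst.aemeasurable, ?_⟩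
    rw [Measure.map_apply measurable_fst isClosed_closure.measurableSet.compl]
    have hG : IsOpen (Prod.fst ⁻¹' (closure Λ)ᶜ : Set (EucD D × EucD D)) :=
      isClosed_closure.isOpen_compl.preimage continuous_fst
    refine le_antisymm ((hopens _ hG).trans ?_) zero_le
    have : ∀ j, emp2 D (φ j) (Xg (φ j)) (Prod.fst ⁻¹' (closure Λ)ᶜ) = 0 := fun j ↦
      emp2_apply_eq_zero hG.measurableSet fun i _ hi ↦ hi ((hXg _ (hφ2 j)).1 i)
    simp only [this, liminf_const, le_refl]
  refine ⟨μ.map Prod.fst, hρ, hprod, le_antisymm (le_iInf₂ fun ρ hρ' ↦ ?_) (iInf₂_le _ hρ)⟩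
  have hlsc : LowerSemicontinuous fun p ↦ extendedInteraction U Λ p / 2 := by
    refine (ENNReal.continuous_div_const 2 (by simp)).comp_lowerSemicontinuous
      hU.lowerSemicontinuous_extendedInteraction fun a b hab ↦ ?_
    exact ENNReal.div_le_div_right hab 2
  rw [hU.pairingE_eq hρ, ← hprod]
  refine (hlsc.lintegral_le_liminf hopens).trans ?_
  refine liminf_le_of_frequently_le' (Eventually.of_forall fun j ↦ ?_).frequently
  obtain ⟨q, hq, hle⟩ := hU.exists_interactionE_le hρ' (hφ2 j)
  rw [hU.lintegral_emp2_eq (hXg _ (hφ2 j)).1]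
  exact (mul_le_mul_right ((hXg _ (hφ2 j)).2 q hq) _).trans hle
end
end
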